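/- arXiv:1906.08790 — 2 statements merged into one kernel-verified Lean document; each statement's English description precedes it below -/
import Mathlib

section
/- Fix an integer n ≥ 1 and consider the open set U = {(a, r) ∈ ℝ² : a ≠ 0, r > 0}. The smooth function φ(a, r) = -(n+1)·(r/a)·arctan(a/r) + (n+2) on U satisfies the system of partial differential equations: (i) r·∂φ/∂r + a·∂φ/∂a = 0, and (ii) a·∂φ/∂a - (n+1)·a²/(a² + r²) + φ = 1. -/
open Real

/-- The coefficient function `φ(a, r) = -(n+1)·(r/a)·arctan(a/r) + (n+2)` entering the
construction of an invariant potential for the rescaled volume form on `ℝ^{n+1} ∖ {0}`. -/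
noncomputable def phiFun (n : ℕ) (a r : ℝ) : ℝ :=
  -((n : ℝ) + 1) * (r / a) * Real.arctan (a / r) + ((n : ℝ) + 2)

theorem hasDerivAt_phiFun_left (n : ℕ) {a r : ℝ} (ha : a ≠ 0) (hr : r ≠ 0) :
    HasDerivAt (fun t => phiFun n t r)
      (((n : ℝ) + 1) * (r / a ^ 2) * arctan (a / r)
        - ((n : ℝ) + 1) * r ^ 2 / (a * (a ^ 2 + r ^ 2))) a := by
  have hinv : HasDerivAt (fun t : ℝ => r / t) (-(r / a ^ 2)) a :=
    ((hasDerivAt_inv ha).const_mul r).congr_deriv (by ring)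
  have harc := ((hasDerivAt_id a).div_const r).arctan
  refine (((hinv.const_mul (-((n : ℝ) + 1))).mul harc).add_const ((n : ℝ) + 2)).congr_deriv ?_
  simp only [id]
  field_simp
  ring

theorem hasDerivAt_phiFun_right (n : ℕ) {a r : ℝ} (ha : a ≠ 0) (hr : r ≠ 0) :
    HasDerivAt (fun s => phiFun n a s)
      (-((n : ℝ) + 1) * (1 / a) * arctan (a / r)
        + ((n : ℝ) + 1) * r / (a ^ 2 + r ^ 2)) r := by
  have hinv : HasDerivAt (fun s : ℝ => a / s) (-(a / r ^ 2)) r :=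
    ((hasDerivAt_inv hr).const_mul a).congr_deriv (by ring)
  have hlin := ((hasDerivAt_id r).div_const a).const_mul (-((n : ℝ) + 1))
  refine ((hlin.mul hinv.arctan).add_const ((n : ℝ) + 2)).congr_deriv ?_
  simp only [id]
  field_simp
  ring

theorem contDiffOn_phiFun (n : ℕ) {k : WithTop ℕ∞} :
    ContDiffOn ℝ k (fun p : ℝ × ℝ => phiFun n p.1 p.2) {p : ℝ × ℝ | p.1 ≠ 0 ∧ p.2 ≠ 0} := by
  have hra : ContDiffOn ℝ k (fun p : ℝ × ℝ => p.2 / p.1) {p : ℝ × ℝ | p.1 ≠ 0 ∧ p.2 ≠ 0} :=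
    contDiffOn_snd.div contDiffOn_fst fun _ hp => hp.1
  have har : ContDiffOn ℝ k (fun p : ℝ × ℝ => p.1 / p.2) {p : ℝ × ℝ | p.1 ≠ 0 ∧ p.2 ≠ 0} :=
    contDiffOn_fst.div contDiffOn_snd fun _ hp => hp.2
  exact ((contDiffOn_const.mul hra).mul (contDiff_arctan.comp_contDiffOn har)).add
    contDiffOn_const

/-- on `U = {(a, r) : a ≠ 0, r > 0}` the function `φ` is smooth and satisfies
(i) `r·∂φ/∂r + a·∂φ/∂a = 0` (invariance under the Euler vector field) and
(ii) `a·∂φ/∂a - (n+1)·a²/(a²+r²) + φ = 1` (the primitivity condition). -/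
theorem phiFun_smooth_and_solves_PDEs (n : ℕ) (hn : 1 ≤ n) :
    ContDiffOn ℝ (⊤ : ℕ∞) (fun p : ℝ × ℝ => phiFun n p.1 p.2)
        {p : ℝ × ℝ | p.1 ≠ 0 ∧ 0 < p.2} ∧
      ∀ a r : ℝ, a ≠ 0 → 0 < r →
        r * deriv (fun s => phiFun n a s) r + a * deriv (fun t => phiFun n t r) a = 0 ∧
        a * deriv (fun t => phiFun n t r) a
            - ((n : ℝ) + 1) * a ^ 2 / (a ^ 2 + r ^ 2) + phiFun n a r = 1 := by
  refine ⟨(contDiffOn_phiFun n).mono fun p hp => ⟨hp.1, hp.2.ne'⟩, fun a r ha hr => ?_⟩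
  rw [(hasDerivAt_phiFun_left n ha hr.ne').deriv, (hasDerivAt_phiFun_right n ha hr.ne').deriv]
  constructor
  · field_simp
    ring
  · unfold phiFun
    field_simp
    ring
end

section
/- Let n ≥ 2, let N = e₁ be the first standard basis vector of ℂⁿ, and let S^{2n-1} denote the unit sphere of ℂⁿ. The orbit map θ_N : SU(n) → S^{2n-1}, A ↦ A·N, is continuous and induces a nonzero (equivalently, surjective) map on (2n-1)-st singular homology with real coefficients, θ_{N*} : H_{2n-1}(SU(n); ℝ) → H_{2n-1}(S^{2n-1}; ℝ) ≅ ℝ. (Dually, the pullback under θ_N of the fundamental cohomology class of S^{2n-1} is nonzero in H^{2n-1}(SU(n); ℝ); this is the obstruction showing the transitive SU(n)-action on S^{2n-1} admits no homotopy comoment map.) -/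
open CategoryTheory

/-- The singular chain complex functor with real coefficients, defined via the singular
simplicial set. -/
noncomputable def singularChainComplexFunctor : TopCat.{0} ⥤ ChainComplex (ModuleCat.{0} ℝ) ℕ :=
  TopCat.toSSet ⋙ ((SimplicialObject.whiskering _ _).obj (ModuleCat.free ℝ)) ⋙
    AlgebraicTopology.alternatingFaceMapComplex _

/-- Singular homology with real coefficients, as a functor `TopCat ⥤ ModuleCat ℝ`. -/
noncomputable def singularHomologyFunctor (n : ℕ) : TopCat.{0} ⥤ ModuleCat.{0} ℝ :=
  singularChainComplexFunctor ⋙ HomologicalComplex.homologyFunctor _ _ n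

section CubeStokes

open MeasureTheory Set Filter Topology

/-- The integral over the open unit cube of the pullback under `u` of the `m`-form
`y ↦ D (y, ⋯)`, which restricts to a multiple of the volume form on the unit sphere. -/
noncomputable def cubeIntegral {E : Type*} [NormedAddCommGroup E] [NormedSpace ℝ E] {m : ℕ}
    (D : E [⋀^Fin (m + 1)]→L[ℝ] ℝ) (u : (Fin m → ℝ) → E) : ℝ :=
  ∫ t in Set.pi univ (fun _ : Fin m => Ioo (0 : ℝ) 1),
    D.curryLeft (u t) (fun i => fderiv ℝ u t (Pi.single i 1))

variable {E : Type*} [NormedAddCommGroup E] [NormedSpace ℝ E] {m : ℕ}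

theorem isOpen_openCube : IsOpen (Set.pi univ (fun _ : Fin m => Ioo (0 : ℝ) 1)) :=
  isOpen_set_pi finite_univ fun _ _ => isOpen_Ioo

theorem openCube_subset_Icc :
    Set.pi univ (fun _ : Fin m => Ioo (0 : ℝ) 1) ⊆ Icc (0 : Fin m → ℝ) 1 :=
  fun _ ht => ⟨fun i => (ht i trivial).1.le, fun i => (ht i trivial).2.le⟩

theorem openCube_ae_eq_Icc :
    (Set.pi univ (fun _ : Fin m => Ioo (0 : ℝ) 1)) =ᵐ[volume] Icc (0 : Fin m → ℝ) 1 :=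
  Measure.univ_pi_Ioo_ae_eq_Icc (f := (0 : Fin m → ℝ)) (g := 1)

theorem cubeIntegral_congr (D : E [⋀^Fin (m + 1)]→L[ℝ] ℝ) {u u' : (Fin m → ℝ) → E}
    (h : EqOn u u' (Icc 0 1)) : cubeIntegral D u = cubeIntegral D u' := by
  refine setIntegral_congr_fun isOpen_openCube.measurableSet fun t ht => ?_
  have he : u =ᶠ[𝓝 t] u' :=
    Filter.mem_of_superset (isOpen_openCube.mem_nhds ht) fun s hs => h (openCube_subset_Icc hs)
  simp only [he.fderiv_eq, he.eq_of_nhds]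

theorem cubeIntegral_eq_zero_of_fderiv_eq_zero (D : E [⋀^Fin (m + 1)]→L[ℝ] ℝ)
    {u : (Fin m → ℝ) → E} (i : Fin m)
    (h : ∀ t ∈ Icc (0 : Fin m → ℝ) 1, fderiv ℝ u t (Pi.single i 1) = 0) :
    cubeIntegral D u = 0 := by
  refine setIntegral_eq_zero_of_forall_eq_zero fun t ht => ?_
  exact (D.curryLeft (u t)).map_coord_zero i (h t (openCube_subset_Icc ht))

theorem ContinuousAlternatingMap.extDeriv_curryLeft (D : E [⋀^Fin (m + 1)]→L[ℝ] ℝ) (y : E) :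
    extDeriv (fun y => D.curryLeft y) y = (m + 1) • D := by
  rw [extDeriv, ContinuousLinearMap.fderiv, alternatizeUncurryFin_curryLeft]

theorem fderiv_inner_eq_zero_of_norm_eq_one {E F : Type*} [NormedAddCommGroup E]
    [InnerProductSpace ℝ E] [NormedAddCommGroup F] [NormedSpace ℝ F]
    {u : F → E} {x : F} (hu : DifferentiableAt ℝ u x)
    (hn : ∀ᶠ y in 𝓝 x, ‖u y‖ = 1) (ξ : F) : inner ℝ (u x) (fderiv ℝ u x ξ) = 0 := by
  have h1 : (fun y => inner ℝ (u y) (u y)) =ᶠ[𝓝 x] fun _ => (1 : ℝ) :=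
    hn.mono fun y hy => by simp [hy]
  have h2 := congrArg (fun L : F →L[ℝ] ℝ => L ξ) h1.fderiv_eq
  simp only [fderiv_inner_apply ℝ hu hu, fderiv_fun_const] at h2
  rw [real_inner_comm (u x)] at h2
  simp at h2
  linarith [real_inner_comm (u x) (fderiv ℝ u x ξ)]

theorem AlternatingMap.eq_zero_of_inner_eq_zero {E : Type*} [NormedAddCommGroup E]
    [InnerProductSpace ℝ E] [FiniteDimensional ℝ E] (hE : Module.finrank ℝ E = m + 1)
    (D : E [⋀^Fin (m + 1)]→ₗ[ℝ] ℝ) {y : E} (hy : y ≠ 0) {v : Fin (m + 1) → E}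
    (hv : ∀ i, inner ℝ y (v i) = 0) : D v = 0 := by
  refine D.map_linearDependent v fun hli => hy ?_
  have hs := hli.span_eq_top_of_card_eq_finrank' (by simp [hE])
  have : y ∈ (Submodule.span ℝ (Set.range v))ᗮ := by
    rw [Submodule.mem_orthogonal']
    intro w hw
    induction hw using Submodule.span_induction with
    | mem w hw => obtain ⟨i, rfl⟩ := hw; exact hv i
    | zero => simp
    | add a b _ _ ha hb => rw [inner_add_right, ha, hb, add_zero]
    | smul c a _ ha => rw [inner_smul_right, ha, mul_zero]
  rw [hs] at this
  simpa using this

/-- The linear part of the affine map `t ↦ i.insertNth c t`. -/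
noncomputable def insertNthCLM (i : Fin (m + 1)) : (Fin m → ℝ) →L[ℝ] (Fin (m + 1) → ℝ) :=
  ContinuousLinearMap.pi (i.insertNth (0 : (Fin m → ℝ) →L[ℝ] ℝ) ContinuousLinearMap.proj)

theorem insertNthCLM_single (i : Fin (m + 1)) (j : Fin m) :
    insertNthCLM i (Pi.single j 1) = Pi.single (i.succAbove j) 1 := by
  ext k
  refine Fin.succAboveCases i ?_ (fun k => ?_) k
  · simp [insertNthCLM]
  · simp [insertNthCLM, Pi.single_apply]

theorem hasFDerivAt_insertNth (i : Fin (m + 1)) (c : ℝ) (t : Fin m → ℝ) :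
    HasFDerivAt (fun t : Fin m → ℝ => (i.insertNth c t : Fin (m + 1) → ℝ)) (insertNthCLM i) t := by
  refine hasFDerivAt_pi.2 fun k => ?_
  refine Fin.succAboveCases i ?_ (fun k => ?_) k
  · simpa using hasFDerivAt_const c t
  · simpa using hasFDerivAt_apply k t

theorem contDiff_insertNth {r : WithTop ℕ∞} (i : Fin (m + 1)) (c : ℝ) :
    ContDiff ℝ r (fun t : Fin m → ℝ => (i.insertNth c t : Fin (m + 1) → ℝ)) := by
  refine contDiff_pi.2 fun k => ?_
  refine Fin.succAboveCases i ?_ (fun k => ?_) k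
  · simpa using contDiff_const
  · simpa using contDiff_apply ℝ ℝ k

theorem insertNth_mem_Icc {i : Fin (m + 1)} {c : ℝ} (hc : c ∈ Icc (0 : ℝ) 1) {t : Fin m → ℝ}
    (ht : t ∈ Icc (0 : Fin m → ℝ) 1) :
    (i.insertNth c t : Fin (m + 1) → ℝ) ∈ Icc (0 : Fin (m + 1) → ℝ) 1 := by
  constructor
  · intro k
    refine Fin.succAboveCases i ?_ (fun k => ?_) k
    · simpa using hc.1
    · simpa using ht.1 k
  · intro k
    refine Fin.succAboveCases i ?_ (fun k => ?_) k
    · simpa using hc.2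
    · simpa using ht.2 k

/-- Stokes' theorem on the unit cube for a map into the unit sphere. -/
theorem sum_cubeIntegral_faces_eq_zero {E : Type*} [NormedAddCommGroup E]
    [InnerProductSpace ℝ E] [FiniteDimensional ℝ E] (hE : Module.finrank ℝ E = m + 1)
    (D : E [⋀^Fin (m + 1)]→L[ℝ] ℝ) {u : (Fin (m + 1) → ℝ) → E}
    (hu : ∀ x ∈ Icc (0 : Fin (m + 1) → ℝ) 1, ContDiffAt ℝ 2 u x)
    (hn : ∀ x ∈ Icc (0 : Fin (m + 1) → ℝ) 1, ∀ᶠ y in 𝓝 x, ‖u y‖ = 1) :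
    ∑ i : Fin (m + 1), (-1 : ℝ) ^ (i : ℕ) *
      (cubeIntegral D (fun t => u (i.insertNth 1 t)) -
        cubeIntegral D (fun t => u (i.insertNth 0 t))) = 0 := by
  set e : Fin (m + 1) → Fin (m + 1) → ℝ := fun i => Pi.single i 1 with he
  set ω : (Fin (m + 1) → ℝ) → (Fin (m + 1) → ℝ) [⋀^Fin m]→L[ℝ] ℝ :=
    fun x => (D.curryLeft (u x)).compContinuousLinearMap (fderiv ℝ u x) with hω
  have hdω : ∀ x ∈ Icc (0 : Fin (m + 1) → ℝ) 1, DifferentiableAt ℝ ω x := by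
    intro x hx
    have h1 : DifferentiableAt ℝ (fun x => D.curryLeft (u x)) x :=
      D.curryLeft.differentiableAt.comp x ((hu x hx).differentiableAt (by norm_num))
    have h2 : DifferentiableAt ℝ (fderiv ℝ u) x :=
      ((hu x hx).fderiv_right (m := 1) (by norm_num)).differentiableAt (by norm_num)
    exact (h1.hasFDerivAt.continuousAlternatingMapCompContinuousLinearMap
      h2.hasFDerivAt).differentiableAt
  have hext : ∀ x ∈ Icc (0 : Fin (m + 1) → ℝ) 1, extDeriv ω x e = 0 := by
    intro x hx
    have h0 : D.toAlternatingMap (fun i => fderiv ℝ u x (e i)) = 0 := by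
      refine AlternatingMap.eq_zero_of_inner_eq_zero hE _ (y := u x) ?_ fun i => ?_
      · have := (hn x hx).self_of_nhds
        intro h
        simp [h] at this
      · exact fderiv_inner_eq_zero_of_norm_eq_one ((hu x hx).differentiableAt (by norm_num))
          (hn x hx) _
    rw [hω, extDeriv_pullback (r := 2) D.curryLeft.differentiableAt (hu x hx) (by simp),
      ContinuousAlternatingMap.extDeriv_curryLeft]
    simp only [ContinuousAlternatingMap.compContinuousLinearMap_apply,
      ContinuousAlternatingMap.smul_apply]
    rw [show D (⇑(fderiv ℝ u x) ∘ e) = 0 from h0, smul_zero]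
  set f : Fin (m + 1) → (Fin (m + 1) → ℝ) → ℝ :=
    fun i x => (-1 : ℝ) ^ (i : ℕ) * ω x (i.removeNth e) with hf
  have hdf : ∀ x ∈ Icc (0 : Fin (m + 1) → ℝ) 1, ∀ i, DifferentiableAt ℝ (f i) x := by
    intro x hx i
    have : DifferentiableAt ℝ (fun x => ω x (i.removeNth e)) x :=
      ((hdω x hx).hasFDerivAt.continuousAlternatingMap_apply_const _).differentiableAt
    exact this.const_mul _
  have hsum : ∀ x ∈ Icc (0 : Fin (m + 1) → ℝ) 1,
      ∑ i, fderiv ℝ (f i) x (Pi.single i 1) = 0 := by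
    intro x hx
    rw [← hext x hx, extDeriv_apply (hdω x hx)]
    refine Finset.sum_congr rfl fun i _ => ?_
    have : DifferentiableAt ℝ (fun x => ω x (i.removeNth e)) x :=
      ((hdω x hx).hasFDerivAt.continuousAlternatingMap_apply_const _).differentiableAt
    simp only [hf]
    rw [fderiv_const_mul this]
    simp [he]
  have hdiv := integral_divergence_of_hasFDerivAt_off_countable' (0 : Fin (m + 1) → ℝ) 1
    (by intro i; simp) f (fun i x => fderiv ℝ (f i) x) ∅ countable_empty
    (fun i x hx => (hdf x hx i).continuousAt.continuousWithinAt)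
    (fun x hx i => (hdf x (openCube_subset_Icc (by simpa using hx)) i).hasFDerivAt)
    ((integrableOn_congr_fun hsum measurableSet_Icc).2 integrableOn_zero)
  rw [setIntegral_congr_fun measurableSet_Icc hsum, integral_zero] at hdiv
  refine Eq.trans ?_ hdiv.symm
  refine Finset.sum_congr rfl fun i _ => ?_
  have key : ∀ c ∈ Icc (0 : ℝ) 1,
      ∫ t in Icc (0 : Fin m → ℝ) 1, f i (i.insertNth c t) =
        (-1 : ℝ) ^ (i : ℕ) * cubeIntegral D (fun t => u (i.insertNth c t)) := by
    intro c hc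
    rw [cubeIntegral, ← integral_const_mul,
      setIntegral_congr_set openCube_ae_eq_Icc]
    refine setIntegral_congr_fun measurableSet_Icc fun t ht => ?_
    have hd := ((hu _ (insertNth_mem_Icc (i := i) hc ht)).differentiableAt
      (by norm_num)).hasFDerivAt.comp t (hasFDerivAt_insertNth i c t)
    simp only [hf, hω, ContinuousAlternatingMap.compContinuousLinearMap_apply]
    congr 2
    funext j
    erw [hd.fderiv]
    simp [he, insertNthCLM_single, Fin.removeNth]
  rw [mul_sub]
  exact (congrArg₂ (· - ·) (key 1 (by simp)) (key 0 (by simp))).symm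

end CubeStokes

section Simplex

open MeasureTheory Set Filter Topology

/-- The collapse map from the cube onto the standard simplex, with coordinates
`t₀ ⋯ tᵢ₋₁ (1 - tᵢ)`. -/
def cubeCollapse : ∀ m : ℕ, (Fin m → ℝ) → (Fin (m + 1) → ℝ)
  | 0, _ => fun _ => 1
  | m + 1, t => Fin.cons (1 - t 0) (t 0 • cubeCollapse m (Fin.tail t))

theorem contDiff_cubeCollapse {r : WithTop ℕ∞} (m : ℕ) : ContDiff ℝ r (cubeCollapse m) := by
  induction m with
  | zero => exact contDiff_const
  | succ m ih =>
    have ht : ContDiff ℝ r (fun t : Fin (m + 1) → ℝ => (Fin.tail t : Fin m → ℝ)) :=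
      contDiff_pi.2 fun k => contDiff_apply ℝ ℝ k.succ
    refine contDiff_pi.2 fun k => ?_
    refine Fin.cases ?_ (fun k => ?_) k
    · simpa [cubeCollapse] using contDiff_const.sub (contDiff_apply ℝ ℝ (0 : Fin (m + 1)))
    · simpa [cubeCollapse] using (contDiff_apply ℝ ℝ (0 : Fin (m + 1))).mul
        (contDiff_pi.1 (ih.comp ht) k)

theorem cubeCollapse_mem_stdSimplex (m : ℕ) {t : Fin m → ℝ} (ht : t ∈ Icc (0 : Fin m → ℝ) 1) :
    cubeCollapse m t ∈ stdSimplex ℝ (Fin (m + 1)) := by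
  induction m with
  | zero => exact ⟨fun _ => zero_le_one, by simp [cubeCollapse]⟩
  | succ m ih =>
    have h := ih (t := Fin.tail t) ⟨fun k => ht.1 k.succ, fun k => ht.2 k.succ⟩
    constructor
    · intro k
      refine Fin.cases ?_ (fun k => ?_) k
      · simpa [cubeCollapse] using ht.2 0
      · simpa [cubeCollapse] using mul_nonneg (ht.1 0) (h.1 k)
    · simp [cubeCollapse, Fin.sum_univ_succ, ← Finset.mul_sum, h.2]

theorem smul_insertNth_zero {m : ℕ} (j : Fin (m + 1)) (c : ℝ) (t : Fin m → ℝ) :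
    c • (j.insertNth 0 t : Fin (m + 1) → ℝ) = j.insertNth 0 (c • t) := by
  ext k
  refine Fin.succAboveCases j ?_ (fun k => ?_) k <;> simp

theorem cubeCollapse_succ_cons (m : ℕ) (c : ℝ) (t : Fin m → ℝ) :
    cubeCollapse (m + 1) (Fin.cons c t) = Fin.cons (1 - c) (c • cubeCollapse m t) := by
  simp [cubeCollapse]

theorem cubeCollapse_insertNth_one (m : ℕ) (j : Fin (m + 1)) (t : Fin m → ℝ) :
    cubeCollapse (m + 1) (j.insertNth 1 t) = j.castSucc.insertNth 0 (cubeCollapse m t) := by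
  induction m with
  | zero =>
    obtain rfl : j = 0 := Fin.fin_one_eq_zero j
    simp [cubeCollapse_succ_cons, Fin.insertNth_zero']
  | succ m ih =>
    refine Fin.cases ?_ (fun j => ?_) j
    · simp [cubeCollapse_succ_cons, Fin.insertNth_zero']
    · rw [← Fin.cons_self_tail t, Fin.insertNth_succ_cons, cubeCollapse_succ_cons, ih,
        smul_insertNth_zero, cubeCollapse_succ_cons, ← Fin.succ_castSucc, Fin.insertNth_succ_cons]

theorem cubeCollapse_insertNth_last_zero (m : ℕ) (t : Fin m → ℝ) :
    cubeCollapse (m + 1) ((Fin.last m).insertNth 0 t) =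
      (Fin.last (m + 1)).insertNth 0 (cubeCollapse m t) := by
  induction m with
  | zero =>
    ext k
    refine Fin.lastCases ?_ (fun k => ?_) k
    · simp [cubeCollapse, Fin.last]
    · obtain rfl : k = 0 := Fin.fin_one_eq_zero k
      rw [Fin.insertNth_last' (n := 1), Fin.snoc_castSucc (n := 1)]
      simp [cubeCollapse]
  | succ m ih =>
    rw [← Fin.cons_self_tail t, ← Fin.succ_last, Fin.insertNth_succ_cons, cubeCollapse_succ_cons,
      ih, smul_insertNth_zero, cubeCollapse_succ_cons, ← Fin.succ_last (m + 1),
      Fin.insertNth_succ_cons]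

theorem cubeCollapse_congr {m : ℕ} {s t : Fin m → ℝ} (i : Fin m) (h : ∀ k ≤ i, s k = t k)
    (hi : s i = 0) : cubeCollapse m s = cubeCollapse m t := by
  induction m with
  | zero => rfl
  | succ m ih =>
    rw [cubeCollapse, cubeCollapse, h 0 (Fin.zero_le i)]
    congr 1
    refine Fin.cases (fun h hi => ?_) (fun i h hi => ?_) i h hi
    · simp [← h 0 le_rfl, hi]
    · rw [ih (s := Fin.tail s) (t := Fin.tail t) i (fun k hk => h k.succ (Fin.succ_le_succ_iff.2 hk)) hi]

theorem insertNth_zero_mem_stdSimplex {m : ℕ} (j : Fin (m + 2)) {x : Fin (m + 1) → ℝ} :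
    (j.insertNth 0 x : Fin (m + 2) → ℝ) ∈ stdSimplex ℝ (Fin (m + 2)) ↔
      x ∈ stdSimplex ℝ (Fin (m + 1)) := by
  simp [stdSimplex, Fin.sum_univ_succAbove _ j, Fin.forall_iff_succAbove j]

variable {E : Type*} [NormedAddCommGroup E] [InnerProductSpace ℝ E]

/-- Radial projection onto the unit sphere. -/
noncomputable def radialProj (y : E) : E := ‖y‖⁻¹ • y

theorem norm_radialProj {y : E} (hy : y ≠ 0) : ‖radialProj y‖ = 1 := by
  rw [radialProj, norm_smul, norm_inv, norm_norm, inv_mul_cancel₀ (norm_ne_zero_iff.2 hy)]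

theorem radialProj_of_norm_eq_one {y : E} (hy : ‖y‖ = 1) : radialProj y = y := by
  simp [radialProj, hy]

theorem contDiffAt_radialProj {r : WithTop ℕ∞} {y : E} (hy : y ≠ 0) :
    ContDiffAt ℝ r (radialProj : E → E) y :=
  ((contDiffAt_norm ℝ hy).inv (norm_ne_zero_iff.2 hy)).smul contDiffAt_id

/-- The integral of the volume form over the radial projection of the singular simplex `V`. -/
noncomputable def simplexIntegral {m : ℕ} (D : E [⋀^Fin (m + 1)]→L[ℝ] ℝ)
    (V : (Fin (m + 1) → ℝ) → E) : ℝ :=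
  cubeIntegral D (fun t => radialProj (V (cubeCollapse m t)))

/-- The integral of the volume form over the radial projection of a homotopy of singular
simplices. -/
noncomputable def homotopyIntegral {m : ℕ} (D : E [⋀^Fin (m + 2)]→L[ℝ] ℝ)
    (W : ℝ → (Fin (m + 1) → ℝ) → E) : ℝ :=
  cubeIntegral D (fun t => radialProj (W (t 0) (cubeCollapse m (Fin.tail t))))

theorem tail_mem_Icc {m : ℕ} {t : Fin (m + 1) → ℝ} (ht : t ∈ Icc (0 : Fin (m + 1) → ℝ) 1) :
    Fin.tail t ∈ Icc (0 : Fin m → ℝ) 1 :=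
  ⟨fun k => ht.1 k.succ, fun k => ht.2 k.succ⟩

theorem homotopyIntegral_congr {m : ℕ} (D : E [⋀^Fin (m + 2)]→L[ℝ] ℝ)
    {W W' : ℝ → (Fin (m + 1) → ℝ) → E}
    (h : ∀ s, EqOn (W s) (W' s) (stdSimplex ℝ (Fin (m + 1)))) :
    homotopyIntegral D W = homotopyIntegral D W' :=
  cubeIntegral_congr D fun _ ht => congrArg radialProj
    (h _ (cubeCollapse_mem_stdSimplex m (tail_mem_Icc ht)))

theorem sum_cubeIntegral_radialProj_faces_eq_zero {m : ℕ} [FiniteDimensional ℝ E]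
    (hE : Module.finrank ℝ E = m + 1) (D : E [⋀^Fin (m + 1)]→L[ℝ] ℝ) {P : (Fin (m + 1) → ℝ) → E}
    (hP : ∀ x ∈ Icc (0 : Fin (m + 1) → ℝ) 1, ContDiffAt ℝ 2 P x)
    (h0 : ∀ x ∈ Icc (0 : Fin (m + 1) → ℝ) 1, P x ≠ 0) :
    ∑ i : Fin (m + 1), (-1 : ℝ) ^ (i : ℕ) *
      (cubeIntegral D (fun t => radialProj (P (i.insertNth 1 t))) -
        cubeIntegral D (fun t => radialProj (P (i.insertNth 0 t)))) = 0 :=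
  sum_cubeIntegral_faces_eq_zero hE D (u := fun x => radialProj (P x))
    (fun x hx => (contDiffAt_radialProj (h0 x hx)).comp x (hP x hx))
    (fun x hx => ((hP x hx).continuousAt.eventually_ne (h0 x hx)).mono
      fun _ hy => norm_radialProj hy)

/-- A cube map that does not depend on its last coordinate has integral zero. -/
theorem cubeIntegral_eq_zero_of_update_last {F : Type*} [NormedAddCommGroup F] [NormedSpace ℝ F]
    {m : ℕ} (D : F [⋀^Fin (m + 2)]→L[ℝ] ℝ) {u : (Fin (m + 1) → ℝ) → F}
    (h : ∀ t c, u (Function.update t (Fin.last m) c) = u t) : cubeIntegral D u = 0 := by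
  refine cubeIntegral_eq_zero_of_fderiv_eq_zero D (Fin.last m) fun t _ => ?_
  by_cases hd : DifferentiableAt ℝ u t
  · have hl := hd.hasFDerivAt.hasLineDerivAt (Pi.single (Fin.last m) 1)
    have hc : HasLineDerivAt ℝ u 0 t (Pi.single (Fin.last m) 1) := by
      have : (fun s : ℝ => u (t + s • Pi.single (Fin.last m) 1)) = fun _ => u t := by
        funext s
        rw [← h t (t (Fin.last m) + s)]
        congr 1
        ext k
        by_cases hk : k = Fin.last m
        · subst hk; simp
        · simp [hk]
      rw [HasLineDerivAt, this]
      exact hasDerivAt_const _ _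
    exact hl.unique hc
  · simp [fderiv_zero_of_not_differentiableAt hd]

theorem Fin.not_succAbove_last_le {m : ℕ} (i : Fin (m + 1)) :
    ¬ i.castSucc.succAbove (Fin.last m) ≤ i.castSucc := by
  intro hk
  have := lt_of_le_of_ne hk (Fin.succAbove_ne _ _)
  rw [Fin.succAbove_lt_iff_castSucc_lt, Fin.castSucc_lt_castSucc_iff] at this
  exact absurd this (Fin.not_lt.2 (Fin.le_last i))

theorem sum_simplexIntegral_faces_eq_zero {m : ℕ} [FiniteDimensional ℝ E]
    (hE : Module.finrank ℝ E = m + 1) (D : E [⋀^Fin (m + 1)]→L[ℝ] ℝ) {V : (Fin (m + 2) → ℝ) → E}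
    (hV : ∀ x ∈ stdSimplex ℝ (Fin (m + 2)), ContDiffAt ℝ 2 V x)
    (h0 : ∀ x ∈ stdSimplex ℝ (Fin (m + 2)), V x ≠ 0) :
    ∑ i : Fin (m + 2), (-1 : ℝ) ^ (i : ℕ) * simplexIntegral D (fun x => V (i.insertNth 0 x)) = 0 := by
  have h := sum_cubeIntegral_radialProj_faces_eq_zero hE D (P := fun t => V (cubeCollapse (m + 1) t))
    (fun x hx => (hV _ (cubeCollapse_mem_stdSimplex _ hx)).comp x
      (contDiff_cubeCollapse (m + 1)).contDiffAt)
    (fun x hx => h0 _ (cubeCollapse_mem_stdSimplex _ hx))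
  have hz : ∀ i : Fin m, cubeIntegral D
      (fun t => radialProj (V (cubeCollapse (m + 1) (i.castSucc.insertNth 0 t)))) = 0 := by
    intro i
    obtain _ | m := m
    · exact i.elim0
    refine cubeIntegral_eq_zero_of_update_last D fun t c => ?_
    rw [cubeCollapse_congr i.castSucc _ (by simp)]
    intro k hk
    refine Fin.succAboveCases i.castSucc ?_ (fun k hk => ?_) k hk
    · simp
    · simp only [Fin.insertNth_apply_succAbove]
      rw [Function.update_of_ne]
      rintro rfl
      exact Fin.not_succAbove_last_le i hk
  rw [Fin.sum_univ_castSucc] at h ⊢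
  simp only [cubeCollapse_insertNth_one, cubeCollapse_insertNth_last_zero, hz, sub_zero] at h
  rw [Fin.sum_univ_castSucc]
  simp only [simplexIntegral]
  simp only [Fin.val_castSucc, Fin.val_last] at h ⊢
  rw [pow_succ]
  linear_combination h

theorem simplexIntegral_sub_eq_sum_homotopyIntegral {m : ℕ} [FiniteDimensional ℝ E]
    (hE : Module.finrank ℝ E = m + 2) (D : E [⋀^Fin (m + 2)]→L[ℝ] ℝ)
    {W : ℝ → (Fin (m + 2) → ℝ) → E}
    (hW : ∀ s ∈ Icc (0 : ℝ) 1, ∀ x ∈ stdSimplex ℝ (Fin (m + 2)),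
      ContDiffAt ℝ 2 (fun p : ℝ × (Fin (m + 2) → ℝ) => W p.1 p.2) (s, x))
    (h0 : ∀ s ∈ Icc (0 : ℝ) 1, ∀ x ∈ stdSimplex ℝ (Fin (m + 2)), W s x ≠ 0) :
    simplexIntegral D (W 1) - simplexIntegral D (W 0) =
      ∑ i : Fin (m + 2), (-1 : ℝ) ^ (i : ℕ) *
        homotopyIntegral D (fun s x => W s (i.insertNth 0 x)) := by
  have hP : ContDiff ℝ 2 (fun t : Fin (m + 2) → ℝ => (t 0, cubeCollapse (m + 1) (Fin.tail t))) :=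
    (contDiff_apply ℝ ℝ (0 : Fin (m + 2))).prodMk ((contDiff_cubeCollapse (m + 1)).comp
      (contDiff_pi.2 fun k => contDiff_apply ℝ ℝ k.succ))
  have h := sum_cubeIntegral_radialProj_faces_eq_zero hE D
    (P := fun t => W (t 0) (cubeCollapse (m + 1) (Fin.tail t)))
    (fun x hx => ContDiffAt.comp (g := fun p : ℝ × (Fin (m + 2) → ℝ) => W p.1 p.2) x
      (hW (x 0) ⟨hx.1 0, hx.2 0⟩ (cubeCollapse (m + 1) (Fin.tail x))
        (cubeCollapse_mem_stdSimplex _ (tail_mem_Icc hx))) hP.contDiffAt)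
    (fun x hx => h0 _ ⟨hx.1 0, hx.2 0⟩ _ (cubeCollapse_mem_stdSimplex _ (tail_mem_Icc hx)))
  have h1 : ∀ (i : Fin (m + 1)) (c : ℝ) (t : Fin (m + 1) → ℝ),
      (i.succ.insertNth c t : Fin (m + 2) → ℝ) = Fin.cons (t 0) (i.insertNth c (Fin.tail t)) := by
    intro i c t
    rw [← Fin.insertNth_succ_cons, Fin.cons_self_tail]
  have hz : ∀ i : Fin m, cubeIntegral D (fun t : Fin (m + 1) → ℝ => radialProj
      (W (t 0) (cubeCollapse (m + 1) (i.castSucc.insertNth 0 (Fin.tail t))))) = 0 := by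
    intro i
    obtain _ | m := m
    · exact i.elim0
    refine cubeIntegral_eq_zero_of_update_last D fun t c => ?_
    rw [cubeCollapse_congr (t := i.castSucc.insertNth 0 (Fin.tail t)) i.castSucc _ (by simp)]
    · simp
    intro k hk
    refine Fin.succAboveCases i.castSucc ?_ (fun k hk => ?_) k hk
    · simp
    · simp only [Fin.insertNth_apply_succAbove, Fin.tail]
      rw [Function.update_of_ne]
      intro h
      obtain rfl : k = Fin.last m := Fin.succ_injective _ h
      exact Fin.not_succAbove_last_le i hk
  rw [Fin.sum_univ_succ, Fin.sum_univ_castSucc] at h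
  simp only [h1, Fin.insertNth_zero', Fin.cons_zero, Fin.tail_cons, cubeCollapse_insertNth_one,
    cubeCollapse_insertNth_last_zero, hz, sub_zero] at h
  rw [Fin.sum_univ_castSucc, Fin.sum_univ_castSucc]
  simp only [simplexIntegral, homotopyIntegral]
  simp only [Fin.val_castSucc, Fin.val_last, Fin.succ_last, Fin.val_succ, pow_succ, Fin.val_zero] at h ⊢
  simp only [mul_neg, mul_one, neg_mul, Finset.sum_neg_distrib] at h ⊢
  linarith

end Simplex

section Bernstein

open MeasureTheory Set Filter Topology

/-- The empirical distribution of a word `φ` of length `k`. -/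
noncomputable def empiricalPoint {k m : ℕ} (φ : Fin k → Fin m) : Fin m → ℝ :=
  fun i => (∑ j, if φ j = i then (1 : ℝ) else 0) / k

theorem empiricalPoint_mem_stdSimplex {k m : ℕ} (hk : k ≠ 0) (φ : Fin k → Fin m) :
    empiricalPoint φ ∈ stdSimplex ℝ (Fin m) := by
  constructor
  · intro i
    exact div_nonneg (Finset.sum_nonneg fun j _ => by split_ifs <;> norm_num) (Nat.cast_nonneg k)
  · simp only [empiricalPoint]
    rw [← Finset.sum_div, Finset.sum_comm]
    simp [hk]

/-- The sum defining the second moment of an i.i.d. sample of a centred random variable. -/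
theorem sum_prod_mul_sum_sq {m : ℕ} {x : Fin m → ℝ} (hx : ∑ i, x i = 1) {a : Fin m → ℝ}
    (ha : ∑ i, x i * a i = 0) (k : ℕ) :
    ∑ φ : Fin k → Fin m, (∏ j, x (φ j)) * (∑ j, a (φ j)) ^ 2 = k * ∑ i, x i * a i ^ 2 := by
  have h0 : ∀ k : ℕ, ∑ φ : Fin k → Fin m, ∏ j, x (φ j) = 1 := by
    intro k
    rw [← Fintype.sum_pow, hx, one_pow]
  induction k with
  | zero => simp
  | succ k ih =>
    rw [← (Fin.consEquiv fun _ => Fin m).sum_comp, Fintype.sum_prod_type]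
    simp only [Fin.consEquiv, Equiv.coe_fn_mk, Fin.prod_univ_succ, Fin.sum_univ_succ, Fin.cons_zero,
      Fin.cons_succ]
    have : ∀ i, ∑ φ : Fin k → Fin m, (x i * ∏ j, x (φ j)) * (a i + ∑ j, a (φ j)) ^ 2 =
        x i * a i ^ 2 + (x i * a i) * (2 * ∑ φ : Fin k → Fin m, (∏ j, x (φ j)) * ∑ j, a (φ j)) +
          x i * ∑ φ : Fin k → Fin m, (∏ j, x (φ j)) * (∑ j, a (φ j)) ^ 2 := by
      intro i
      rw [← mul_one (x i * a i ^ 2), ← h0 k]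
      simp only [Finset.mul_sum (Finset.univ : Finset (Fin k → Fin m)), ← Finset.sum_add_distrib]
      exact Finset.sum_congr rfl fun φ _ => by ring
    rw [Finset.sum_congr rfl fun i _ => this i, Finset.sum_add_distrib, Finset.sum_add_distrib,
      ← Finset.sum_mul, ha, ih, ← Finset.sum_mul, hx]
    push_cast
    ring

theorem sum_prod_mul_empiricalPoint_sub_sq_le {k m : ℕ} (hk : k ≠ 0) {x : Fin m → ℝ}
    (hx : x ∈ stdSimplex ℝ (Fin m)) (i : Fin m) :
    ∑ φ : Fin k → Fin m, (∏ j, x (φ j)) * (empiricalPoint φ i - x i) ^ 2 ≤ 1 / k := by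
  have hk' : (k : ℝ) ≠ 0 := Nat.cast_ne_zero.2 hk
  set a : Fin m → ℝ := fun l => (if l = i then 1 else 0) - x i with ha
  have ha0 : ∑ l, x l * a l = 0 := by
    simp [ha, mul_sub, Finset.sum_sub_distrib, ← Finset.sum_mul, hx.2]
  have he : ∀ φ : Fin k → Fin m, empiricalPoint φ i - x i = (∑ j, a (φ j)) / k := by
    intro φ
    simp only [ha, empiricalPoint, Finset.sum_sub_distrib]
    field_simp
    simp
  have hle : ∑ l, x l * a l ^ 2 ≤ 1 := by
    rw [← hx.2]
    refine Finset.sum_le_sum fun l _ => mul_le_of_le_one_right (hx.1 l) ?_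
    have h1 := hx.1 i
    have h2 : x i ≤ 1 := (Finset.single_le_sum (fun l _ => hx.1 l) (Finset.mem_univ i)).trans hx.2.le
    simp only [ha]
    split_ifs <;> nlinarith
  have : ∑ φ : Fin k → Fin m, (∏ j, x (φ j)) * (empiricalPoint φ i - x i) ^ 2 =
      (∑ l, x l * a l ^ 2) / k := by
    have := sum_prod_mul_sum_sq hx.2 ha0 k
    simp only [he, div_pow, ← mul_div_assoc, ← Finset.sum_div]
    rw [this]
    field_simp
  rw [this]
  gcongr

variable {E : Type*} [NormedAddCommGroup E] [NormedSpace ℝ E]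

/-- The `k`-th Bernstein polynomial of a function on the standard simplex. -/
noncomputable def simplexBernstein {m : ℕ} (k : ℕ) (σ : (Fin m → ℝ) → E) (x : Fin m → ℝ) : E :=
  ∑ φ : Fin k → Fin m, (∏ j, x (φ j)) • σ (empiricalPoint φ)

theorem contDiff_simplexBernstein {r : WithTop ℕ∞} {m : ℕ} (k : ℕ) (σ : (Fin m → ℝ) → E) :
    ContDiff ℝ r (simplexBernstein k σ) :=
  ContDiff.sum fun φ _ => (contDiff_prod fun j _ => contDiff_apply ℝ ℝ (φ j)).smul contDiff_const

theorem simplexBernstein_congr {m k : ℕ} (hk : k ≠ 0) {σ σ' : (Fin m → ℝ) → E}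
    (h : EqOn σ σ' (stdSimplex ℝ (Fin m))) : simplexBernstein k σ = simplexBernstein k σ' := by
  funext x
  exact Finset.sum_congr rfl fun φ _ => by rw [h (empiricalPoint_mem_stdSimplex hk φ)]

theorem simplexBernstein_insertNth_zero {m : ℕ} (k : ℕ) (σ : (Fin (m + 1) → ℝ) → E)
    (i : Fin (m + 1)) (x : Fin m → ℝ) :
    simplexBernstein k σ (i.insertNth 0 x) =
      simplexBernstein k (fun y => σ (i.insertNth 0 y)) x := by
  symm
  refine Fintype.sum_of_injective (fun φ j => i.succAbove (φ j)) ?_ _ _ ?_ ?_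
  · intro φ ψ h
    funext j
    exact Fin.succAbove_right_injective (congrFun h j)
  · intro φ hφ
    have : ∃ j, φ j = i := by
      by_contra! hne
      choose ψ hψ using fun j => Fin.exists_succAbove_eq (hne j)
      exact hφ ⟨ψ, funext hψ⟩
    obtain ⟨j, hj⟩ := this
    rw [Finset.prod_eq_zero (Finset.mem_univ j) (by simp [hj]), zero_smul]
  · intro φ
    congr 1
    · simp
    · refine congrArg σ (funext fun l => ?_)
      refine Fin.succAboveCases i ?_ (fun l => ?_) l <;>
        simp [empiricalPoint, Fin.succAbove_ne]

theorem eventually_norm_simplexBernstein_sub_lt {m : ℕ} {σ : (Fin m → ℝ) → E}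
    (hσ : ContinuousOn σ (stdSimplex ℝ (Fin m))) {ε : ℝ} (hε : 0 < ε) :
    ∀ᶠ k in atTop, ∀ x ∈ stdSimplex ℝ (Fin m), ‖simplexBernstein k σ x - σ x‖ < ε := by
  obtain ⟨C, hC⟩ := (isCompact_stdSimplex (𝕜 := ℝ) (Fin m)).exists_bound_of_continuousOn hσ
  obtain ⟨δ, hδ, hδσ⟩ := Metric.uniformContinuousOn_iff.1
    ((isCompact_stdSimplex (𝕜 := ℝ) (Fin m)).uniformContinuousOn_of_continuous hσ) (ε / 2) (half_pos hε)
  have key : ∀ x ∈ stdSimplex ℝ (Fin m), ∀ y ∈ stdSimplex ℝ (Fin m),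
      ‖σ y - σ x‖ ≤ ε / 2 + 2 * |C| / δ ^ 2 * ∑ i, (y i - x i) ^ 2 := by
    intro x hx y hy
    have hS : 0 ≤ ∑ i, (y i - x i) ^ 2 := Finset.sum_nonneg fun i _ => sq_nonneg _
    rcases lt_or_ge (dist y x) δ with h | h
    · have := (hδσ y hy x hx h).le
      rw [dist_eq_norm] at this
      have : 0 ≤ 2 * |C| / δ ^ 2 * ∑ i, (y i - x i) ^ 2 := by positivity
      linarith
    · have h1 : ‖σ y - σ x‖ ≤ 2 * |C| := by
        have := norm_sub_le (σ y) (σ x)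
        linarith [hC x hx, hC y hy, le_abs_self C]
      have h2 : δ ^ 2 ≤ ∑ i, (y i - x i) ^ 2 := by
        by_contra! hlt
        refine absurd h (not_le.2 ((dist_pi_lt_iff hδ).2 fun i => ?_))
        rw [Real.dist_eq]
        refine abs_lt_of_sq_lt_sq ?_ hδ.le
        exact (Finset.single_le_sum (f := fun i => (y i - x i) ^ 2) (fun i _ => sq_nonneg _)
          (Finset.mem_univ i)).trans_lt hlt
      have h3 : 2 * |C| ≤ 2 * |C| / δ ^ 2 * ∑ i, (y i - x i) ^ 2 := by
        rw [div_mul_eq_mul_div, le_div_iff₀ (by positivity)]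
        gcongr
      linarith
  have hlim : Tendsto (fun k : ℕ => 2 * |C| / δ ^ 2 * (m * (1 / (k : ℝ)))) atTop (𝓝 0) := by
    simpa using (tendsto_one_div_atTop_nhds_zero_nat.const_mul (m : ℝ)).const_mul (2 * |C| / δ ^ 2)
  filter_upwards [hlim.eventually (gt_mem_nhds (half_pos hε)), eventually_ne_atTop 0] with k hk hk0
  intro x hx
  have hw : ∑ φ : Fin k → Fin m, ∏ j, x (φ j) = 1 := by
    rw [← Fintype.sum_pow, hx.2, one_pow]
  have hw0 : ∀ φ : Fin k → Fin m, 0 ≤ ∏ j, x (φ j) := fun φ => Finset.prod_nonneg fun j _ => hx.1 _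
  have hsub : simplexBernstein k σ x - σ x =
      ∑ φ : Fin k → Fin m, (∏ j, x (φ j)) • (σ (empiricalPoint φ) - σ x) := by
    simp only [smul_sub, Finset.sum_sub_distrib, ← Finset.sum_smul, hw, one_smul, simplexBernstein]
  rw [hsub]
  calc ‖∑ φ : Fin k → Fin m, (∏ j, x (φ j)) • (σ (empiricalPoint φ) - σ x)‖
      ≤ ∑ φ : Fin k → Fin m, (∏ j, x (φ j)) *
        (ε / 2 + 2 * |C| / δ ^ 2 * ∑ i, (empiricalPoint φ i - x i) ^ 2) := by
        refine norm_sum_le_of_le _ fun φ _ => ?_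
        rw [norm_smul, Real.norm_of_nonneg (hw0 φ)]
        exact mul_le_mul_of_nonneg_left (key x hx _ (empiricalPoint_mem_stdSimplex hk0 φ)) (hw0 φ)
    _ = ε / 2 + 2 * |C| / δ ^ 2 *
        ∑ i, ∑ φ : Fin k → Fin m, (∏ j, x (φ j)) * (empiricalPoint φ i - x i) ^ 2 := by
        rw [Finset.sum_comm]
        simp only [mul_add, Finset.sum_add_distrib, ← Finset.sum_mul, hw, one_mul]
        rw [Finset.mul_sum]
        congr 1
        refine Finset.sum_congr rfl fun φ _ => ?_
        rw [← Finset.mul_sum]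
        ring
    _ ≤ ε / 2 + 2 * |C| / δ ^ 2 * (m * (1 / k)) := by
        gcongr
        refine (Finset.sum_le_sum fun i _ =>
          sum_prod_mul_empiricalPoint_sub_sq_le hk0 hx i).trans ?_
        simp
    _ < ε := by linarith

end Bernstein

section Obstruction

open MeasureTheory Set Filter Topology

variable {E : Type*} [NormedAddCommGroup E] [InnerProductSpace ℝ E]

theorem ne_zero_of_norm_sub_lt_one {F : Type*} [NormedAddCommGroup F] {y z : F}
    (hz : ‖z‖ = 1) (h : ‖y - z‖ < 1) : y ≠ 0 := by
  rintro rfl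
  simp [hz] at h

theorem eventually_sum_simplexIntegral_bernstein_faces_eq_zero {m : ℕ} [FiniteDimensional ℝ E]
    (hE : Module.finrank ℝ E = m + 1) (D : E [⋀^Fin (m + 1)]→L[ℝ] ℝ)
    {τ : (Fin (m + 2) → ℝ) → E} (hτ : ContinuousOn τ (stdSimplex ℝ (Fin (m + 2))))
    (hn : ∀ x ∈ stdSimplex ℝ (Fin (m + 2)), ‖τ x‖ = 1) :
    ∀ᶠ k in atTop, ∑ i : Fin (m + 2), (-1 : ℝ) ^ (i : ℕ) *
      simplexIntegral D (simplexBernstein k (fun x => τ (i.insertNth 0 x))) = 0 := by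
  filter_upwards [eventually_norm_simplexBernstein_sub_lt hτ one_pos] with k hk
  have := sum_simplexIntegral_faces_eq_zero hE D (V := simplexBernstein k τ)
    (fun x _ => (contDiff_simplexBernstein k τ).contDiffAt)
    (fun x hx => ne_zero_of_norm_sub_lt_one (hn x hx) (hk x hx))
  simpa only [simplexBernstein_insertNth_zero] using this

/-- The integral of the volume form over the straight-line homotopy from the `k`-th Bernstein
polynomial of `ρ` to `ρ`. -/
noncomputable def bernsteinHomotopyIntegral {m : ℕ} (D : E [⋀^Fin (m + 2)]→L[ℝ] ℝ) (k : ℕ)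
    (ρ : (Fin (m + 1) → ℝ) → E) : ℝ :=
  homotopyIntegral D fun s x => (1 - s) • simplexBernstein k ρ x + s • ρ x

theorem eventually_simplexIntegral_sub_bernstein {m : ℕ} [FiniteDimensional ℝ E]
    (hE : Module.finrank ℝ E = m + 2) (D : E [⋀^Fin (m + 2)]→L[ℝ] ℝ)
    {σ : (Fin (m + 2) → ℝ) → E} (hσ : ContDiff ℝ 2 σ)
    (hn : ∀ x ∈ stdSimplex ℝ (Fin (m + 2)), ‖σ x‖ = 1) :
    ∀ᶠ k in atTop, simplexIntegral D σ - simplexIntegral D (simplexBernstein k σ) =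
      ∑ i : Fin (m + 2), (-1 : ℝ) ^ (i : ℕ) *
        bernsteinHomotopyIntegral D k (fun x => σ (i.insertNth 0 x)) := by
  filter_upwards [eventually_norm_simplexBernstein_sub_lt hσ.continuous.continuousOn one_pos]
    with k hk
  have := simplexIntegral_sub_eq_sum_homotopyIntegral hE D
    (W := fun s x => (1 - s) • simplexBernstein k σ x + s • σ x)
    (fun s _ x _ => (((contDiff_const.sub contDiff_fst).smul
      ((contDiff_simplexBernstein k σ).comp contDiff_snd)).add
        (contDiff_fst.smul (hσ.comp contDiff_snd))).contDiffAt)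
    (fun s hs x hx => by
      refine ne_zero_of_norm_sub_lt_one (hn x hx) ?_
      have h1 : (1 - s) • simplexBernstein k σ x + s • σ x - σ x =
          (1 - s) • (simplexBernstein k σ x - σ x) := by module
      rw [h1, norm_smul, Real.norm_of_nonneg (by linarith [hs.2])]
      exact (mul_le_of_le_one_left (norm_nonneg _) (by linarith [hs.1])).trans_lt (hk x hx))
  simpa only [simplexBernstein_insertNth_zero, sub_self, zero_smul, one_smul, zero_add, sub_zero,
    add_zero, bernsteinHomotopyIntegral] using this

/-- If a smooth spherical singular cycle bounds a continuous chain in the sphere, then the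
integral of the volume form over it vanishes. -/
theorem sum_simplexIntegral_eq_zero_of_boundary {m : ℕ} [FiniteDimensional ℝ E]
    (hE : Module.finrank ℝ E = m + 2) (D : E [⋀^Fin (m + 2)]→L[ℝ] ℝ) {ι κ : Type*}
    [Fintype ι] [Fintype κ] (r : ι → ℝ) (σ : ι → (Fin (m + 2) → ℝ) → E)
    (hσ : ∀ a, ContDiff ℝ 2 (σ a)) (hσn : ∀ a, ∀ x ∈ stdSimplex ℝ (Fin (m + 2)), ‖σ a x‖ = 1)
    (hcycle : ∀ Φ : ((Fin (m + 1) → ℝ) → E) → ℝ,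
      (∀ ρ ρ', EqOn ρ ρ' (stdSimplex ℝ (Fin (m + 1))) → Φ ρ = Φ ρ') →
      ∑ a, r a * ∑ i : Fin (m + 2), (-1 : ℝ) ^ (i : ℕ) * Φ (fun x => σ a (i.insertNth 0 x)) = 0)
    (y : κ → ℝ) (τ : κ → (Fin (m + 3) → ℝ) → E)
    (hτ : ∀ b, ContinuousOn (τ b) (stdSimplex ℝ (Fin (m + 3))))
    (hτn : ∀ b, ∀ x ∈ stdSimplex ℝ (Fin (m + 3)), ‖τ b x‖ = 1)
    (hbdry : ∀ Φ : ((Fin (m + 2) → ℝ) → E) → ℝ,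
      (∀ ρ ρ', EqOn ρ ρ' (stdSimplex ℝ (Fin (m + 2))) → Φ ρ = Φ ρ') →
      ∑ a, r a * Φ (σ a) = ∑ b, y b * ∑ i : Fin (m + 3), (-1 : ℝ) ^ (i : ℕ) *
        Φ (fun x => τ b (i.insertNth 0 x))) :
    ∑ a, r a * simplexIntegral D (σ a) = 0 := by
  obtain ⟨k, hk1, hk2, hk0⟩ := (((eventually_all.2 fun b =>
    eventually_sum_simplexIntegral_bernstein_faces_eq_zero hE D (hτ b) (hτn b)).and
    ((eventually_all.2 fun a => eventually_simplexIntegral_sub_bernstein hE D (hσ a) (hσn a)).and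
      (eventually_ne_atTop 0))).exists)
  have hA : ∑ a, r a * simplexIntegral D (simplexBernstein k (σ a)) = 0 := by
    rw [hbdry (fun ρ => simplexIntegral D (simplexBernstein k ρ))
      (fun ρ ρ' h => by rw [simplexBernstein_congr hk0 h])]
    simp [hk1]
  have hB := hcycle (bernsteinHomotopyIntegral D k) (fun ρ ρ' h =>
    homotopyIntegral_congr D fun s x hx => by
      simp only [simplexBernstein_congr hk0 h, h hx])
  simp only [← hk2, mul_sub, Finset.sum_sub_distrib, hA, sub_zero] at hB
  exact hB

end Obstruction

section SingularChains

open Simplicial Opposite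

/-- The `i`-th face inclusion of standard simplices. -/
def stdSimplexFace {m : ℕ} (i : Fin (m + 2)) :
    C(stdSimplex ℝ (Fin (m + 1)), stdSimplex ℝ (Fin (m + 2))) where
  toFun x := ⟨i.insertNth 0 (x : Fin (m + 1) → ℝ), (insertNth_zero_mem_stdSimplex i).2 x.2⟩
  continuous_toFun := ((contDiff_insertNth (r := 0) i 0).continuous.comp
    continuous_subtype_val).subtype_mk _

theorem stdSimplexMap_succAbove {m : ℕ} (i : Fin (m + 2)) (x : stdSimplex ℝ (Fin (m + 1))) :
    stdSimplex.map i.succAbove x = stdSimplexFace i x := by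
  ext k
  rw [stdSimplex.map_coe, FunOnFinite.linearMap_apply_apply]
  change _ = (i.insertNth 0 (x : Fin (m + 1) → ℝ) : Fin (m + 2) → ℝ) k
  refine Fin.succAboveCases i ?_ (fun k => ?_) k
  · simp [Fin.succAbove_ne]
  · simp [Finset.filter_eq']

theorem toSSetObjEquiv_δ {X : TopCat.{0}} {m : ℕ} (i : Fin (m + 2))
    (s : (TopCat.toSSet.obj X) _⦋m + 1⦌) :
    X.toSSetObjEquiv (op ⦋m⦌) ((TopCat.toSSet.obj X).δ i s) =
      (X.toSSetObjEquiv (op ⦋m + 1⦌) s).comp (stdSimplexFace i) := by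
  ext x
  change _ = (X.toSSetObjEquiv (op ⦋m + 1⦌) s) (stdSimplexFace i x)
  rw [← stdSimplexMap_succAbove]
  rfl

/-- The generator of the singular chain module given by a singular simplex. -/
noncomputable def singularGenerator (X : TopCat.{0}) (m : ℕ)
    (σ : C(stdSimplex ℝ (Fin (m + 1)), X)) : (singularChainComplexFunctor.obj X).X m :=
  ModuleCat.freeMk ((X.toSSetObjEquiv (op ⦋m⦌)).symm σ)

/-- The linear functional on singular chains extending a function on singular simplices. -/
noncomputable def singularFunctional (X : TopCat.{0}) (m : ℕ)
    (Φ : C(stdSimplex ℝ (Fin (m + 1)), X) → ℝ) :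
    (singularChainComplexFunctor.obj X).X m →ₗ[ℝ] ℝ :=
  Finsupp.linearCombination ℝ fun s : (TopCat.toSSet.obj X) _⦋m⦌ =>
    Φ (X.toSSetObjEquiv (op ⦋m⦌) s)

theorem singularFunctional_generator (X : TopCat.{0}) (m : ℕ)
    (Φ : C(stdSimplex ℝ (Fin (m + 1)), X) → ℝ) (σ : C(stdSimplex ℝ (Fin (m + 1)), X)) :
    singularFunctional X m Φ (singularGenerator X m σ) = Φ σ := by
  refine (Finsupp.linearCombination_single ℝ _ _).trans ?_
  simp

theorem singularChain_d_generator (X : TopCat.{0}) (m : ℕ)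
    (σ : C(stdSimplex ℝ (Fin (m + 2)), X)) :
    (singularChainComplexFunctor.obj X).d (m + 1) m (singularGenerator X (m + 1) σ) =
      ∑ i : Fin (m + 2), (-1 : ℝ) ^ (i : ℕ) • singularGenerator X m (σ.comp (stdSimplexFace i)) := by
  have h : (singularChainComplexFunctor.obj X).d (m + 1) m = ∑ i : Fin (m + 2), (-1 : ℤ) ^ (i : ℕ) •
      (ModuleCat.free ℝ).map ((TopCat.toSSet.obj X).δ i) :=
    AlgebraicTopology.alternatingFaceMapComplex_obj_d _ _
  have hsum : ∀ {M N : ModuleCat.{0} ℝ} (f : Fin (m + 2) → (M ⟶ N)) (x : M),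
      (∑ i : Fin (m + 2), (-1 : ℤ) ^ (i : ℕ) • f i).hom x =
        ∑ i : Fin (m + 2), (-1 : ℝ) ^ (i : ℕ) • (f i).hom x := by
    intro M N f x
    simp [ModuleCat.hom_sum, ← Int.cast_smul_eq_zsmul ℝ]
  refine (congrArg (fun g => g.hom (singularGenerator X (m + 1) σ)) h).trans ?_
  refine (hsum _ _).trans (Finset.sum_congr rfl fun i _ => congrArg _ ?_)
  refine (ModuleCat.free_map_apply _ _).trans ?_
  rw [singularGenerator]
  congr 1
  apply (X.toSSetObjEquiv (op ⦋m⦌)).injective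
  rw [toSSetObjEquiv_δ]
  simp

theorem singularChain_map_generator {X Y : TopCat.{0}} (θ : X ⟶ Y) (m : ℕ)
    (σ : C(stdSimplex ℝ (Fin (m + 1)), X)) :
    (singularChainComplexFunctor.map θ).f m (singularGenerator X m σ) =
      singularGenerator Y m (θ.hom.comp σ) := by
  refine (ModuleCat.free_map_apply _ _).trans ?_
  rw [singularGenerator]
  congr 1

theorem exists_eq_sum_singularGenerator {X : TopCat.{0}} {m : ℕ}
    (z : (singularChainComplexFunctor.obj X).X m) :
    ∃ (κ : Type) (_ : Fintype κ) (y : κ → ℝ) (τ : κ → C(stdSimplex ℝ (Fin (m + 1)), X)),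
      z = ∑ b, y b • singularGenerator X m (τ b) := by
  let z' : ((TopCat.toSSet.obj X) _⦋m⦌) →₀ ℝ := z
  refine ⟨z'.support, inferInstance, fun b => z' b, fun b => X.toSSetObjEquiv (op ⦋m⦌) b.1, ?_⟩
  have : z' = ∑ b : z'.support, z' b • Finsupp.single b.1 (1 : ℝ) := by
    conv_lhs => rw [← Finsupp.sum_single z', Finsupp.sum, ← Finset.sum_coe_sort]
    simp
  refine this.trans (Finset.sum_congr rfl fun b _ => ?_)
  rw [singularGenerator, Equiv.symm_apply_apply]
  rfl

theorem singularChain_eq_zero {X : TopCat.{0}} {m : ℕ}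
    {z : (singularChainComplexFunctor.obj X).X m} (h : ∀ Φ, singularFunctional X m Φ z = 0) :
    z = 0 := by
  classical
  let z' : ((TopCat.toSSet.obj X) _⦋m⦌) →₀ ℝ := z
  have : z' = 0 := by
    ext s
    have := h (Pi.single (X.toSSetObjEquiv (op ⦋m⦌) s) 1)
    have h' : z'.sum (fun t c => c • (Pi.single (X.toSSetObjEquiv (op ⦋m⦌) s) 1 :
      _ → ℝ) (X.toSSetObjEquiv (op ⦋m⦌) t)) = 0 := this
    simpa [Pi.single_apply, Finsupp.sum_ite_eq'] using h'
  exact this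

theorem exists_d_eq_of_homologyMap_eq_zero {K L : ChainComplex (ModuleCat.{0} ℝ) ℕ} (f : K ⟶ L)
    (m : ℕ) (hf : HomologicalComplex.homologyMap f (m + 1) = 0) (z : K.X (m + 1))
    (hz : K.d (m + 1) m z = 0) : ∃ y : L.X (m + 2), L.d (m + 2) (m + 1) y = f.f (m + 1) z := by
  let x : ModuleCat.of ℝ ℝ ⟶ K.X (m + 1) := ModuleCat.ofHom (LinearMap.toSpanSingleton ℝ _ z)
  have hx : x ≫ K.d (m + 1) m = 0 := by
    ext
    simp [x, hz]
  have hx' : (x ≫ f.f (m + 1)) ≫ L.d (m + 1) m = 0 := by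
    rw [Category.assoc, f.comm, ← Category.assoc, hx, Limits.zero_comp]
  have h : L.liftCycles (x ≫ f.f (m + 1)) m (by simp) hx' ≫ L.homologyπ (m + 1) = 0 := by
    rw [← HomologicalComplex.liftCycles_comp_cyclesMap (hk := hx) (hj := by simp),
      Category.assoc, ← HomologicalComplex.homologyπ_naturality, hf, Limits.comp_zero,
      Limits.comp_zero]
  obtain ⟨A, π, hπ, x₁, hx₁⟩ :=
    (L.liftCycles_comp_homologyπ_eq_zero_iff_up_to_refinements (m + 2) (m + 1) m (by simp)
      (by simp) _ hx').1 h
  obtain ⟨a, ha⟩ := (ModuleCat.epi_iff_surjective π).1 hπ 1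
  refine ⟨x₁ a, ?_⟩
  have := congrArg (fun g => g.hom a) hx₁
  simp [ha, x] at this
  exact this.symm

open Classical in
/-- The extension by zero of a map defined on the standard simplex. -/
noncomputable def simplexExtend {E : Type*} [Zero E] {m : ℕ}
    (ρ : stdSimplex ℝ (Fin (m + 1)) → E) (x : Fin (m + 1) → ℝ) : E :=
  if h : x ∈ stdSimplex ℝ (Fin (m + 1)) then ρ ⟨x, h⟩ else 0

theorem simplexExtend_of_mem {E : Type*} [Zero E] {m : ℕ} (ρ : stdSimplex ℝ (Fin (m + 1)) → E)
    {x : Fin (m + 1) → ℝ} (h : x ∈ stdSimplex ℝ (Fin (m + 1))) : simplexExtend ρ x = ρ ⟨x, h⟩ :=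
  dif_pos h

theorem exists_boundary_of_homologyMap_eq_zero {X Y : TopCat.{0}} {m : ℕ} (θ : X ⟶ Y)
    (hθ : (singularHomologyFunctor (m + 1)).map θ = 0) {ι : Type*} [Fintype ι] (r : ι → ℝ)
    (s : ι → C(stdSimplex ℝ (Fin (m + 2)), X))
    (hs : ∀ Φ : C(stdSimplex ℝ (Fin (m + 1)), X) → ℝ,
      ∑ a, r a * ∑ i : Fin (m + 2), (-1 : ℝ) ^ (i : ℕ) * Φ ((s a).comp (stdSimplexFace i)) = 0) :
    ∃ (κ : Type) (_ : Fintype κ) (y : κ → ℝ) (τ : κ → C(stdSimplex ℝ (Fin (m + 3)), Y)),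
      ∀ Φ : C(stdSimplex ℝ (Fin (m + 2)), Y) → ℝ, ∑ a, r a * Φ (θ.hom.comp (s a)) =
        ∑ b, y b * ∑ i : Fin (m + 3), (-1 : ℝ) ^ (i : ℕ) *
          Φ ((τ b).comp (stdSimplexFace i)) := by
  have hz : (singularChainComplexFunctor.obj X).d (m + 1) m
      (∑ a, r a • singularGenerator X (m + 1) (s a)) = 0 := by
    refine singularChain_eq_zero fun Φ => ?_
    simpa only [map_sum, map_smul, singularChain_d_generator, singularFunctional_generator,
      smul_eq_mul] using hs Φ
  obtain ⟨w, hw⟩ := exists_d_eq_of_homologyMap_eq_zero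
    (singularChainComplexFunctor.map θ) m hθ _ hz
  obtain ⟨κ, hκ, y, τ, rfl⟩ := exists_eq_sum_singularGenerator w
  refine ⟨κ, hκ, y, τ, fun Φ => ?_⟩
  have := congrArg (singularFunctional Y (m + 1) Φ) hw
  simpa only [map_sum, map_smul, singularChain_d_generator, singularChain_map_generator,
    singularFunctional_generator, smul_eq_mul] using this.symm

theorem sum_simplexIntegral_eq_zero_of_homologyMap_eq_zero {E : Type} [NormedAddCommGroup E]
    [InnerProductSpace ℝ E] [FiniteDimensional ℝ E] {m : ℕ} (hE : Module.finrank ℝ E = m + 2)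
    (D : E [⋀^Fin (m + 2)]→L[ℝ] ℝ) {X : TopCat.{0}}
    (θ : X ⟶ TopCat.of (Metric.sphere (0 : E) 1))
    (hθ : (singularHomologyFunctor (m + 1)).map θ = 0) {ι : Type*} [Fintype ι] (r : ι → ℝ)
    (s : ι → C(stdSimplex ℝ (Fin (m + 2)), X))
    (hs : ∀ Φ : C(stdSimplex ℝ (Fin (m + 1)), X) → ℝ,
      ∑ a, r a * ∑ i : Fin (m + 2), (-1 : ℝ) ^ (i : ℕ) * Φ ((s a).comp (stdSimplexFace i)) = 0)
    (σ : ι → (Fin (m + 2) → ℝ) → E) (hσ : ∀ a, ContDiff ℝ 2 (σ a))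
    (hsσ : ∀ a (x : stdSimplex ℝ (Fin (m + 2))), Subtype.val (θ.hom (s a x)) = σ a x) :
    ∑ a, r a * simplexIntegral D (σ a) = 0 := by
  obtain ⟨κ, hκ, y, τ, hτ⟩ := exists_boundary_of_homologyMap_eq_zero θ hθ r s hs
  refine sum_simplexIntegral_eq_zero_of_boundary hE D r σ hσ (fun a x hx => ?_) (fun Φ hΦ => ?_) y
    (fun b => simplexExtend fun x => (τ b x).1) (fun b => ?_) (fun b x hx => ?_) (fun Φ hΦ => ?_)
  · exact (congrArg norm (hsσ a ⟨x, hx⟩)).symm.trans (norm_eq_of_mem_sphere _)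
  · refine Eq.trans ?_ (hs fun ρ => Φ (simplexExtend fun x => (θ.hom (ρ x)).1))
    refine Finset.sum_congr rfl fun a _ => ?_
    congr 1
    refine Finset.sum_congr rfl fun i _ => ?_
    congr 1
    refine hΦ _ _ fun x hx => ?_
    rw [simplexExtend_of_mem _ hx]
    exact (hsσ a (stdSimplexFace i ⟨x, hx⟩)).symm
  · rw [continuousOn_iff_continuous_domRestrict]
    refine (continuous_subtype_val.comp (τ b).continuous).congr fun x => ?_
    exact (simplexExtend_of_mem _ x.2).symm
  · rw [simplexExtend_of_mem _ hx]
    exact norm_eq_of_mem_sphere _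
  · have := hτ fun ρ => Φ (simplexExtend fun x => (ρ x).1)
    refine Eq.trans ?_ (this.trans ?_)
    · refine Finset.sum_congr rfl fun a _ => ?_
      congr 1
      refine hΦ _ _ fun x hx => ?_
      rw [simplexExtend_of_mem _ hx]
      exact (hsσ a ⟨x, hx⟩).symm
    · refine Finset.sum_congr rfl fun b _ => ?_
      congr 1
      refine Finset.sum_congr rfl fun i _ => ?_
      congr 1
      refine hΦ _ _ fun x hx => ?_
      rw [simplexExtend_of_mem _ hx,
        simplexExtend_of_mem _ ((insertNth_zero_mem_stdSimplex i).2 hx)]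
      rfl

end SingularChains

section CubeCycle

open Finset Equiv

/-- The affine map from the standard simplex onto the simplex `1 ≥ u 0 ≥ u 1 ≥ ⋯ ≥ 0` in the
cube, given by tail sums of barycentric coordinates. -/
def tailSum {m : ℕ} (x : Fin (m + 1) → ℝ) (l : Fin m) : ℝ :=
  ∑ i, if l.castSucc < i then x i else 0

theorem contDiff_tailSum {m : ℕ} {r : WithTop ℕ∞} :
    ContDiff ℝ r (tailSum : (Fin (m + 1) → ℝ) → Fin m → ℝ) := by
  unfold tailSum
  refine contDiff_pi.2 fun l => ContDiff.sum fun i _ => ?_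
  split_ifs <;> fun_prop

theorem tailSum_insertNth {m : ℕ} (j : Fin (m + 1)) (y : Fin m → ℝ) (l : Fin m) :
    tailSum (j.insertNth 0 y) l = ∑ i, if l.castSucc < j.succAbove i then y i else 0 := by
  rw [tailSum, Fin.sum_univ_succAbove _ j]
  simp

theorem tailSum_insertNth_zero_zero {m : ℕ} (y : Fin (m + 1) → ℝ) :
    tailSum ((0 : Fin (m + 2)).insertNth 0 y) 0 = ∑ i, y i := by
  rw [tailSum_insertNth]
  simp

theorem tailSum_insertNth_last_last {m : ℕ} (y : Fin (m + 1) → ℝ) :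
    tailSum ((Fin.last (m + 1)).insertNth 0 y) (Fin.last m) = 0 := by
  rw [tailSum_insertNth]
  refine sum_eq_zero fun i _ => if_neg ?_
  simpa using Fin.le_last i

theorem tailSum_insertNth_last_castSucc {m : ℕ} (y : Fin (m + 1) → ℝ) (l : Fin m) :
    tailSum ((Fin.last (m + 1)).insertNth 0 y) l.castSucc =
      tailSum ((0 : Fin (m + 2)).insertNth 0 y) l.succ := by
  rw [tailSum_insertNth, tailSum_insertNth]
  refine sum_congr rfl fun i _ => ?_
  refine if_congr ?_ rfl rfl
  simp only [Fin.succAbove_last, Fin.succAbove_zero, Fin.lt_def, Fin.val_castSucc, Fin.val_succ]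
  omega

theorem tailSum_insertNth_castSucc_succ {m : ℕ} (y : Fin (m + 1) → ℝ) (j : Fin m) :
    tailSum (j.castSucc.succ.insertNth 0 y) j.castSucc =
      tailSum (j.castSucc.succ.insertNth 0 y) j.succ := by
  refine sum_congr rfl fun i _ => ?_
  by_cases h : i = j.castSucc.succ
  · simp [h]
  · refine if_congr ?_ rfl rfl
    simp only [Fin.lt_def, Fin.ext_iff, Fin.val_castSucc, Fin.val_succ] at h ⊢
    omega

theorem tailSum_cons_zero {m : ℕ} (a : ℝ) (x : Fin (m + 1) → ℝ) :
    tailSum (Fin.cons a x : Fin (m + 2) → ℝ) 0 = ∑ i, x i := by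
  rw [tailSum, Fin.sum_univ_succ]
  simp

theorem tailSum_cons_succ {m : ℕ} (a : ℝ) (x : Fin (m + 1) → ℝ) (l : Fin m) :
    tailSum (Fin.cons a x : Fin (m + 2) → ℝ) l.succ = tailSum x l := by
  rw [tailSum, Fin.sum_univ_succ, tailSum]
  simp [Fin.lt_def]

theorem tailSum_smul {m : ℕ} (c : ℝ) (x : Fin (m + 1) → ℝ) (l : Fin m) :
    tailSum (c • x) l = c * tailSum x l := by
  simp [tailSum, mul_sum]

theorem sum_cubeCollapse {m : ℕ} (t : Fin m → ℝ) : ∑ i, cubeCollapse m t i = 1 := by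
  induction m with
  | zero => simp [cubeCollapse]
  | succ m ih =>
    rw [cubeCollapse, Fin.sum_univ_succ]
    simp [← mul_sum, ih]

theorem tailSum_cubeCollapse {m : ℕ} (t : Fin m → ℝ) (l : Fin m) :
    tailSum (cubeCollapse m t) l = ∏ i ∈ Iic l, t i := by
  induction m with
  | zero => exact l.elim0
  | succ m ih =>
    have hIic : ∀ l : Fin m, Iic l.succ = insert 0 ((Iic l).map (Fin.succEmb m)) := by
      intro l
      ext i
      refine Fin.cases (by simp) (fun i => ?_) i
      simp only [mem_Iic, mem_insert, mem_map, Fin.coe_succEmb, Fin.succ_le_succ_iff,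
        Fin.succ_ne_zero, false_or, Fin.succ_inj, exists_eq_right]
    rw [cubeCollapse]
    refine Fin.cases ?_ (fun l => ?_) l
    · have : Iic (0 : Fin (m + 1)) = {0} := by ext i; simp
      rw [tailSum_cons_zero, this, prod_singleton]
      simp [← mul_sum, sum_cubeCollapse]
    · rw [tailSum_cons_succ, tailSum_smul, ih, hIic, prod_insert (by simp), prod_map]
      rfl

theorem Equiv.Perm.sum_sign_mul_eq_zero_of_mul_right {α : Type*} [Fintype α] [DecidableEq α]
    (F : Perm α → ℝ) (σ : Perm α) (hσ : Perm.sign σ = -1) (hF : ∀ π, F (π * σ) = F π) :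
    ∑ π : Perm α, ((Perm.sign π : ℤ) : ℝ) * F π = 0 := by
  have := Equiv.sum_comp (Equiv.mulRight σ) fun π : Perm α => ((Perm.sign π : ℤ) : ℝ) * F π
  simp [hσ, hF] at this
  linarith

theorem Equiv.Perm.sum_sign_mul_eq_zero_of_mul_left {α : Type*} [Fintype α] [DecidableEq α]
    (F : Perm α → ℝ) (σ : Perm α) (hσ : Perm.sign σ = -1) (hF : ∀ π, F (σ * π) = F π) :
    ∑ π : Perm α, ((Perm.sign π : ℤ) : ℝ) * F π = 0 := by
  have := Equiv.sum_comp (Equiv.mulLeft σ) fun π : Perm α => ((Perm.sign π : ℤ) : ℝ) * F π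
  simp [hσ, hF] at this
  linarith

/-- Two conditions under which the faces `u k = 0` and `u k = 1` of the cube do not contribute
to the boundary of its image under `f`: either the two faces have the same image, or the image of
each of them is invariant under the transposition of two further coordinates. -/
def FacesCancel {ι X : Type*} [DecidableEq ι] (f : (ι → ℝ) → X) (k : ι) : Prop :=
  (∀ u, f (Function.update u k 1) = f (Function.update u k 0)) ∨
    ∀ ε : ℝ, ε = 0 ∨ ε = 1 → ∃ p q, p ≠ q ∧ k ≠ p ∧ k ≠ q ∧
      ∀ u, f (Function.update (u ∘ swap p q) k ε) = f (Function.update u k ε)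

theorem sum_sign_ends_eq_zero {m : ℕ} {X Y : Type*} (f : (Fin (m + 1) → ℝ) → X)
    (hf : ∀ k, FacesCancel f k) (u : Y → Fin (m + 1) → ℝ) (Φ : (Y → X) → ℝ) :
    ∑ π : Perm (Fin (m + 1)), ((Perm.sign π : ℤ) : ℝ) *
      (Φ (fun y => f (Function.update (u y) 0 1 ∘ π.symm)) -
        Φ (fun y => f (Function.update (u y) 0 0 ∘ π.symm))) = 0 := by
  have hup : ∀ (π : Perm (Fin (m + 1))) (ε : ℝ) (v : Fin (m + 1) → ℝ),
      Function.update v 0 ε ∘ π.symm = Function.update (v ∘ π.symm) (π 0) ε := by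
    intro π ε v
    rw [Function.update_comp_equiv, Equiv.symm_symm]
  simp only [hup]
  have key : ∀ k, ∑ π : Perm (Fin (m + 1)), ((Perm.sign π : ℤ) : ℝ) * (if π 0 = k then
      (Φ (fun y => f (Function.update (u y ∘ π.symm) k 1)) -
        Φ (fun y => f (Function.update (u y ∘ π.symm) k 0))) else 0) = 0 := by
    intro k
    rcases hf k with h | h
    · simp [h]
    · have hε : ∀ ε : ℝ, ε = 0 ∨ ε = 1 → ∑ π : Perm (Fin (m + 1)), ((Perm.sign π : ℤ) : ℝ) *
          (if π 0 = k then Φ (fun y => f (Function.update (u y ∘ π.symm) k ε)) else 0) = 0 := by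
        intro ε hε
        obtain ⟨p, q, hpq, hp, hq, h⟩ := h ε hε
        refine Perm.sum_sign_mul_eq_zero_of_mul_left _ (swap p q) (Perm.sign_swap hpq) fun π => ?_
        have h1 : (swap p q * π) 0 = k ↔ π 0 = k := by
          rw [Perm.mul_apply, ← swap_apply_of_ne_of_ne hp hq, (swap p q).injective.eq_iff,
            swap_apply_of_ne_of_ne hp hq]
        refine if_congr h1 ?_ rfl
        congr 1
        funext y
        exact h (u y ∘ π.symm)
      have h0 := hε 0 (Or.inl rfl)
      have h1 := hε 1 (Or.inr rfl)
      refine Eq.trans ?_ (sub_eq_zero.2 (h1.trans h0.symm))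
      rw [← sum_sub_distrib]
      refine sum_congr rfl fun π _ => ?_
      split_ifs <;> ring
  have := sum_eq_zero fun k (_ : k ∈ (univ : Finset (Fin (m + 1)))) => key k
  rw [sum_comm] at this
  refine Eq.trans (sum_congr rfl fun π _ => ?_) this
  rw [← mul_sum]
  simp

/-- The chain given by the subdivision of the cube into simplices indexed by permutations is a
cycle after composition with a map satisfying `FacesCancel` in every coordinate. -/
theorem sum_sign_faces_eq_zero {m : ℕ} {X : Type*} (f : (Fin (m + 1) → ℝ) → X)
    (hf : ∀ k, FacesCancel f k) (Φ : (stdSimplex ℝ (Fin (m + 1)) → X) → ℝ) :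
    ∑ π : Perm (Fin (m + 1)), ((Perm.sign π : ℤ) : ℝ) * ∑ i : Fin (m + 2), (-1 : ℝ) ^ (i : ℕ) *
      Φ (fun y => f (tailSum (i.insertNth 0 y.1) ∘ π.symm)) = 0 := by
  simp only [mul_sum]
  rw [sum_comm, Fin.sum_univ_succ, Fin.sum_univ_castSucc]
  have hmid : ∀ i : Fin m, ∑ π : Perm (Fin (m + 1)), ((Perm.sign π : ℤ) : ℝ) *
      ((-1 : ℝ) ^ ((i.castSucc.succ : Fin (m + 2)) : ℕ) *
        Φ (fun y => f (tailSum (i.castSucc.succ.insertNth 0 y.1) ∘ π.symm))) = 0 := by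
    intro i
    refine Perm.sum_sign_mul_eq_zero_of_mul_right _ (swap i.castSucc i.succ)
      (Perm.sign_swap (by simp [Fin.ext_iff])) fun π => ?_
    congr 2
    funext y
    congr 1
    funext l
    change tailSum _ ((swap i.castSucc i.succ) (π.symm l)) = tailSum _ (π.symm l)
    have := tailSum_insertNth_castSucc_succ y.1 i
    rcases eq_or_ne (π.symm l) i.castSucc with h | h
    · rw [h, swap_apply_left, this]
    · rcases eq_or_ne (π.symm l) i.succ with h' | h'
      · rw [h', swap_apply_right, this]
      · rw [swap_apply_of_ne_of_ne h h']
  rw [sum_eq_zero fun i _ => hmid i, zero_add,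
    ← Equiv.sum_comp (Equiv.mulRight (finRotate (m + 1))) fun π : Perm (Fin (m + 1)) =>
      ((Perm.sign π : ℤ) : ℝ) * ((-1 : ℝ) ^ (((Fin.last m).succ : Fin (m + 2)) : ℕ) *
        Φ (fun y => f (tailSum ((Fin.last m).succ.insertNth 0 y.1) ∘ π.symm))),
    ← sum_add_distrib]
  refine Eq.trans (sum_congr rfl fun π _ => ?_) (sum_sign_ends_eq_zero f hf
    (fun y : stdSimplex ℝ (Fin (m + 1)) => tailSum ((0 : Fin (m + 2)).insertNth 0 y.1)) Φ)
  have h0 : ∀ y : stdSimplex ℝ (Fin (m + 1)),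
      Function.update (tailSum ((0 : Fin (m + 2)).insertNth 0 y.1)) 0 1 =
        tailSum ((0 : Fin (m + 2)).insertNth 0 y.1) := by
    intro y
    rw [Function.update_eq_self_iff, tailSum_insertNth_zero_zero]
    exact y.2.2.symm
  have h1 : ∀ y : stdSimplex ℝ (Fin (m + 1)),
      Function.update (tailSum ((0 : Fin (m + 2)).insertNth 0 y.1)) 0 0 ∘ finRotate (m + 1) =
        tailSum ((Fin.last (m + 1)).insertNth 0 y.1) := by
    intro y
    funext l
    refine Fin.lastCases ?_ (fun l => ?_) l
    · rw [Function.comp_apply, finRotate_last, Function.update_self, tailSum_insertNth_last_last]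
    · rw [Function.comp_apply, finRotate_apply, Fin.coeSucc_eq_succ,
        Function.update_of_ne (Fin.succ_ne_zero l), tailSum_insertNth_last_castSucc]
  have h2 : ∀ y : stdSimplex ℝ (Fin (m + 1)),
      tailSum ((Fin.last m).succ.insertNth 0 y.1) ∘ (π * finRotate (m + 1)).symm =
        Function.update (tailSum ((0 : Fin (m + 2)).insertNth 0 y.1)) 0 0 ∘ π.symm := by
    intro y
    rw [Fin.succ_last, ← h1 y]
    funext l
    simp [Perm.mul_def]
  have hs : ((-1 : ℝ) ^ m) * (-1) ^ m = 1 := by rw [← mul_pow]; simp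
  simp only [h0, h2, Equiv.coe_mulRight, Perm.sign_mul, sign_finRotate]
  push_cast
  simp only [Fin.val_zero, pow_zero, Fin.val_succ, Fin.val_last, pow_succ]
  linear_combination (-(((Perm.sign π : ℤ) : ℝ)) * Φ (fun y => f (Function.update
    (tailSum ((0 : Fin (m + 2)).insertNth 0 y.1)) 0 0 ∘ π.symm))) * hs

end CubeCycle

section SphericalJacobian

open MeasureTheory Finset Equiv

variable {E : Type*} [NormedAddCommGroup E] [NormedSpace ℝ E] {m : ℕ}

/-- The pullback under `G` of the form `y ↦ D (y, ⋯)`, evaluated on the standard basis. -/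
noncomputable def sphericalJacobian (D : E [⋀^Fin (m + 1)]→L[ℝ] ℝ) (G : (Fin m → ℝ) → E)
    (x : Fin m → ℝ) : ℝ :=
  D.curryLeft (G x) fun i => fderiv ℝ G x (Pi.single i 1)

theorem continuous_sphericalJacobian (D : E [⋀^Fin (m + 1)]→L[ℝ] ℝ) {G : (Fin m → ℝ) → E}
    (hG : ContDiff ℝ 1 G) : Continuous (sphericalJacobian D G) := by
  have h1 := hG.continuous_fderiv one_ne_zero
  have h2 := hG.continuous
  refine D.cont.comp (continuous_pi fun i => ?_)
  refine Fin.cases ?_ (fun i => ?_) i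
  · simpa using h2
  · simpa using h1.clm_apply continuous_const

/-- The parametrisation of the simplex `1 ≥ u 0 ≥ u 1 ≥ ⋯ ≥ 0` by the cube. -/
def iicProd (t : Fin m → ℝ) (l : Fin m) : ℝ := ∏ i ∈ Iic l, t i

theorem hasFDerivAt_iicProd (t : Fin m → ℝ) :
    HasFDerivAt iicProd (ContinuousLinearMap.pi fun l => ∑ i ∈ Iic l,
      (∏ j ∈ (Iic l).erase i, t j) • ContinuousLinearMap.proj (R := ℝ) (φ := fun _ => ℝ) i) t :=
  hasFDerivAt_pi.2 fun _ => hasFDerivAt_finsetProd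

theorem sphericalJacobian_comp_iicProd (D : E [⋀^Fin (m + 1)]→L[ℝ] ℝ) {G : (Fin m → ℝ) → E}
    (hG : ContDiff ℝ 1 G) (π : Perm (Fin m)) (t : Fin m → ℝ) :
    sphericalJacobian D (fun t => G (iicProd t ∘ π.symm)) t =
      ((Perm.sign π : ℤ) : ℝ) * ((∏ l, ∏ j ∈ (Iic l).erase l, t j) *
        sphericalJacobian D G (iicProd t ∘ π.symm)) := by
  set x := iicProd t ∘ π.symm with hx
  let L : (Fin m → ℝ) [⋀^Fin m]→ₗ[ℝ] ℝ :=
    (D.curryLeft (G x)).toAlternatingMap.compLinearMap (fderiv ℝ G x).toLinearMap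
  let M : Matrix (Fin m) (Fin m) ℝ := fun i l =>
    if i ≤ l then ∏ j ∈ (Iic l).erase i, t j else 0
  have hperm : HasFDerivAt (fun t : Fin m → ℝ => iicProd t ∘ π.symm) _ t :=
    hasFDerivAt_pi.2 fun l => hasFDerivAt_pi.1 (hasFDerivAt_iicProd t) (π.symm l)
  have hcomp := ((hG.differentiable one_ne_zero x).hasFDerivAt.comp t hperm).fderiv
  have hM : M.det = ∏ l, ∏ j ∈ (Iic l).erase l, t j := by
    rw [Matrix.det_of_isUpperTriangular]
    · simp [M]
    · intro i l hil
      exact if_neg (not_le.2 hil)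
  have hL : ∀ v, L v = (Matrix.of v).det * L fun i => Pi.single i 1 := by
    intro v
    conv_lhs => rw [AlternatingMap.eq_smul_basis_det (Pi.basisFun ℝ (Fin m)) L]
    rw [Pi.basisFun_det, AlternatingMap.smul_apply, smul_eq_mul, mul_comm]
    congr 2
    funext i
    simp
  have h1 : sphericalJacobian D (fun t => G (iicProd t ∘ π.symm)) t =
      L fun i l => M i (π.symm l) := by
    refine congrArg (D.curryLeft (G x)) (funext fun i => ?_)
    refine (congrArg (fun A => A (Pi.single i 1)) hcomp).trans ?_
    refine congrArg (fderiv ℝ G x) (funext fun l => ?_)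
    simp [M, Pi.single_apply]
  have h2 : (Matrix.of fun i l => M i (π.symm l)) = M.submatrix id π.symm := rfl
  rw [h1, hL, h2, Matrix.det_permute', hM]
  simp only [Perm.sign_symm, mul_assoc]
  rfl

theorem simplexIntegral_comp_tailSum {E : Type*} [NormedAddCommGroup E] [InnerProductSpace ℝ E]
    (D : E [⋀^Fin (m + 1)]→L[ℝ] ℝ) {G : (Fin m → ℝ) → E} (hG : ContDiff ℝ 1 G)
    (hGn : ∀ x, ‖G x‖ = 1) (π : Perm (Fin m)) :
    simplexIntegral D (fun x => G (tailSum x ∘ π.symm)) = ((Perm.sign π : ℤ) : ℝ) *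
      ∫ t in Set.pi Set.univ (fun _ : Fin m => Set.Ioo (0 : ℝ) 1), (∏ l, ∏ j ∈ (Iic l).erase l, t j) *
        sphericalJacobian D G (iicProd t ∘ π.symm) := by
  have h : ∀ t, radialProj (G (tailSum (cubeCollapse m t) ∘ π.symm)) =
      G (iicProd t ∘ π.symm) := by
    intro t
    rw [radialProj_of_norm_eq_one (hGn _)]
    congr 1
    funext l
    exact tailSum_cubeCollapse t _
  rw [simplexIntegral, ← integral_const_mul]
  simp only [h]
  exact integral_congr_ae (.of_forall (sphericalJacobian_comp_iicProd D hG π))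

theorem sum_sign_simplexIntegral_pos {E : Type*} [NormedAddCommGroup E] [InnerProductSpace ℝ E]
    (D : E [⋀^Fin (m + 1)]→L[ℝ] ℝ) {G : (Fin m → ℝ) → E} (hG : ContDiff ℝ 1 G)
    (hGn : ∀ x, ‖G x‖ = 1)
    (hJ : ∀ x ∈ Set.pi Set.univ (fun _ : Fin m => Set.Ioo (0 : ℝ) 1), 0 ≤ sphericalJacobian D G x)
    {δ : ℝ} (hδ : 0 < δ) (hJδ : ∀ x ∈ Set.pi Set.univ (fun _ : Fin m => Set.Ioo (0 : ℝ) 1),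
      (∀ i, x i < δ) → 0 < sphericalJacobian D G x) :
    0 < ∑ π : Perm (Fin m), ((Perm.sign π : ℤ) : ℝ) *
      simplexIntegral D (fun x => G (tailSum x ∘ π.symm)) := by
  refine sum_pos (fun π _ => ?_) univ_nonempty
  have hs : ((Perm.sign π : ℤ) : ℝ) * ((Perm.sign π : ℤ) : ℝ) = 1 := by
    rw [← Int.cast_mul, Int.units_coe_mul_self, Int.cast_one]
  rw [simplexIntegral_comp_tailSum D hG hGn, ← mul_assoc, hs, one_mul]
  have hw : ∀ t ∈ Set.pi Set.univ (fun _ : Fin m => Set.Ioo (0 : ℝ) 1),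
      0 < ∏ l, ∏ j ∈ (Iic l).erase l, t j := fun t ht =>
    prod_pos fun l _ => prod_pos fun j _ => (ht j trivial).1
  have hle : ∀ t ∈ Set.pi Set.univ (fun _ : Fin m => Set.Ioo (0 : ℝ) 1), ∀ l, iicProd t l ≤ t l := by
    intro t ht l
    rw [iicProd, ← mul_prod_erase (Iic l) t (mem_Iic.2 le_rfl)]
    exact mul_le_of_le_one_right (ht l trivial).1.le
      (prod_le_one (fun j _ => (ht j trivial).1.le) fun j _ => (ht j trivial).2.le)
  have hmem : ∀ t ∈ Set.pi Set.univ (fun _ : Fin m => Set.Ioo (0 : ℝ) 1),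
      iicProd t ∘ π.symm ∈ Set.pi Set.univ (fun _ : Fin m => Set.Ioo (0 : ℝ) 1) := fun t ht l _ =>
    ⟨prod_pos fun j _ => (ht j trivial).1, (hle t ht _).trans_lt (ht _ trivial).2⟩
  have hcont : Continuous fun t : Fin m → ℝ => (∏ l, ∏ j ∈ (Iic l).erase l, t j) *
      sphericalJacobian D G (iicProd t ∘ π.symm) := by
    have h1 : Continuous fun t : Fin m → ℝ => iicProd t ∘ π.symm :=
      continuous_pi fun l => continuous_finsetProd _ fun j _ => continuous_apply j
    exact (continuous_finsetProd _ fun l _ => continuous_finsetProd _ fun j _ =>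
      continuous_apply j).mul ((continuous_sphericalJacobian D hG).comp h1)
  rw [setIntegral_pos_iff_support_of_nonneg_ae]
  · have hopen : IsOpen (Set.pi Set.univ (fun _ : Fin m => Set.Ioo (0 : ℝ) (min 1 δ))) :=
      isOpen_set_pi Set.finite_univ fun _ _ => isOpen_Ioo
    have hne : (Set.pi Set.univ (fun _ : Fin m => Set.Ioo (0 : ℝ) (min 1 δ))).Nonempty :=
      Set.univ_pi_nonempty_iff.2 fun _ => Set.nonempty_Ioo.2 (by positivity)
    refine (hopen.measure_pos volume hne).trans_le (measure_mono fun t ht => ?_)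
    have ht1 : t ∈ Set.pi Set.univ (fun _ : Fin m => Set.Ioo (0 : ℝ) 1) := fun i _ =>
      ⟨(ht i trivial).1, (ht i trivial).2.trans_le (min_le_left _ _)⟩
    refine ⟨(mul_pos (hw t ht1) (hJδ _ (hmem t ht1) fun i => ?_)).ne', ht1⟩
    exact (hle t ht1 _).trans_lt ((ht _ trivial).2.trans_le (min_le_right _ _))
  · exact ae_restrict_of_forall_mem isOpen_openCube.measurableSet fun t ht =>
      mul_nonneg (hw t ht).le (hJ _ (hmem t ht))
  · exact hcont.integrableOn_Icc.mono_set openCube_subset_Icc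

end SphericalJacobian

section SpecialUnitaryFamily

open Finset Equiv Matrix ComplexConjugate

/-- The point `exp (2πit)` of the unit circle. -/
noncomputable def unitPhase (t : ℝ) : ℂ := Complex.exp ((2 * Real.pi * t : ℝ) * Complex.I)

theorem norm_unitPhase (t : ℝ) : ‖unitPhase t‖ = 1 := Complex.norm_exp_ofReal_mul_I _

theorem unitPhase_ne_zero (t : ℝ) : unitPhase t ≠ 0 := Complex.exp_ne_zero _

theorem unitPhase_add (s t : ℝ) : unitPhase (s + t) = unitPhase s * unitPhase t := by
  rw [unitPhase, unitPhase, unitPhase, ← Complex.exp_add]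
  congr 1
  push_cast
  ring

theorem unitPhase_intCast (k : ℤ) : unitPhase k = 1 := by
  rw [unitPhase, Complex.exp_eq_one_iff]
  exact ⟨k, by push_cast; ring⟩

theorem unitPhase_zero : unitPhase 0 = 1 := by simpa using unitPhase_intCast 0

theorem unitPhase_one : unitPhase 1 = 1 := by simpa using unitPhase_intCast 1

theorem conj_mul_self_of_norm_eq_one {w : ℂ} (hw : ‖w‖ = 1) : conj w * w = 1 := by
  rw [Complex.conj_mul', hw]
  simp

theorem cubeCollapse_castSucc_eq_zero {N : ℕ} (a : Fin N → ℝ) (i : Fin N) (h : a i = 1) :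
    cubeCollapse N a i.castSucc = 0 := by
  induction N with
  | zero => exact i.elim0
  | succ N ih =>
    rw [cubeCollapse]
    revert h
    refine Fin.cases (fun h => ?_) (fun i h => ?_) i
    · simp [h]
    · rw [← Fin.succ_castSucc, Fin.cons_succ, Pi.smul_apply, ih (Fin.tail a) i h, smul_zero]

theorem cubeCollapse_eq_zero_of_lt {N : ℕ} (a : Fin N → ℝ) (i : Fin N) (h : a i = 0)
    (j : Fin (N + 1)) (hj : i.castSucc < j) : cubeCollapse N a j = 0 := by
  induction N with
  | zero => exact i.elim0
  | succ N ih =>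
    rw [cubeCollapse]
    revert h hj
    refine Fin.cases (fun _ hj => absurd hj (Fin.not_lt_zero _)) (fun j => ?_) j
    refine Fin.cases (fun h hj => ?_) (fun i h hj => ?_) i
    · simp [h]
    · rw [Fin.cons_succ, Pi.smul_apply, ih (Fin.tail a) i h j (by simpa [Fin.lt_def] using hj),
        smul_zero]

/-- The partial sums of a finite sequence. -/
def partialSum {N : ℕ} (b : Fin N → ℝ) (j : Fin (N + 1)) : ℝ :=
  ∑ i, if i.castSucc < j then b i else 0

/-- A vector with absolute values `cubeCollapse N a` and phases the partial sums of `b`. -/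
noncomputable def phaseVector {N : ℕ} (a b : Fin N → ℝ) (j : Fin (N + 1)) : ℂ :=
  (cubeCollapse N a j : ℂ) * unitPhase (partialSum b j)

theorem sum_sq_cubeCollapse_pos {N : ℕ} (a : Fin N → ℝ) : 0 < ∑ j, cubeCollapse N a j ^ 2 := by
  obtain ⟨j, -, hj⟩ := exists_ne_zero_of_sum_ne_zero
    ((sum_cubeCollapse a).trans_ne one_ne_zero)
  exact sum_pos' (fun j _ => sq_nonneg _) ⟨j, mem_univ _, by positivity⟩

theorem star_phaseVector_dotProduct {N : ℕ} (a b : Fin N → ℝ) :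
    star (phaseVector a b) ⬝ᵥ phaseVector a b = ((∑ j, cubeCollapse N a j ^ 2 : ℝ) : ℂ) := by
  rw [dotProduct, Complex.ofReal_sum]
  refine sum_congr rfl fun j _ => ?_
  have := conj_mul_self_of_norm_eq_one (norm_unitPhase (partialSum b j))
  simp only [phaseVector, Pi.star_apply, star_mul', Complex.star_def, Complex.conj_ofReal]
  push_cast
  linear_combination (cubeCollapse N a j : ℂ) ^ 2 * this

theorem star_phaseVector_dotProduct_ne_zero {N : ℕ} (a b : Fin N → ℝ) :
    star (phaseVector a b) ⬝ᵥ phaseVector a b ≠ 0 := by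
  rw [star_phaseVector_dotProduct]
  exact_mod_cast (sum_sq_cubeCollapse_pos a).ne'

/-- The matrix acting by `w` on the line spanned by `v` and trivially on the orthogonal
complement, normalised to have determinant one. -/
noncomputable def complexReflection {N : ℕ} (w : ℂ) (v : Fin (N + 1) → ℂ) :
    Matrix (Fin (N + 1)) (Fin (N + 1)) ℂ :=
  (1 + ((w - 1) / (star v ⬝ᵥ v)) • vecMulVec v (star v)) *
    diagonal (Function.update 1 (Fin.last N) (conj w))

theorem complexReflection_smul {N : ℕ} (w : ℂ) (v : Fin (N + 1) → ℂ) {p : ℂ} (hp : ‖p‖ = 1) :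
    complexReflection w (p • v) = complexReflection w v := by
  have hp' := conj_mul_self_of_norm_eq_one hp
  have h1 : vecMulVec (p • v) (star (p • v)) = vecMulVec v (star v) := by
    ext i j
    simp only [vecMulVec_apply, Pi.smul_apply, Pi.star_apply, smul_eq_mul, star_mul',
      Complex.star_def]
    linear_combination (v i * conj (v j)) * hp'
  have h2 : star (p • v) ⬝ᵥ (p • v) = star v ⬝ᵥ v := by
    rw [star_smul, smul_dotProduct, dotProduct_smul, smul_smul, Complex.star_def, hp', one_smul]
  rw [complexReflection, h1, h2, complexReflection]

theorem complexReflection_mem {N : ℕ} {w : ℂ} (hw : ‖w‖ = 1) {v : Fin (N + 1) → ℂ}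
    (hv : star v ⬝ᵥ v ≠ 0) : complexReflection w v ∈ specialUnitaryGroup (Fin (N + 1)) ℂ := by
  have hw' := conj_mul_self_of_norm_eq_one hw
  have hvs : star (star v ⬝ᵥ v) = star v ⬝ᵥ v :=
    (star_dotProduct v v).symm
  have hdiag : (diagonal (Function.update (1 : Fin (N + 1) → ℂ) (Fin.last N) (conj w))) ∈
      unitaryGroup (Fin (N + 1)) ℂ := by
    rw [mem_unitaryGroup_iff', star_eq_conjTranspose, diagonal_conjTranspose,
      diagonal_mul_diagonal, ← diagonal_one]
    congr 1
    funext i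
    rcases eq_or_ne i (Fin.last N) with rfl | hi
    · simp [mul_comm w, hw']
    · simp [hi]
  have hrefl : 1 + ((w - 1) / (star v ⬝ᵥ v)) • vecMulVec v (star v) ∈
      unitaryGroup (Fin (N + 1)) ℂ := by
    have hsq : vecMulVec v (star v) * vecMulVec v (star v) =
        (star v ⬝ᵥ v) • vecMulVec v (star v) := by
      rw [vecMulVec_mul_vecMulVec]
      ext i j
      simp [vecMulVec_apply, mul_comm, mul_assoc]
    have hst : star (vecMulVec v (star v)) = vecMulVec v (star v) := by
      rw [star_eq_conjTranspose, conjTranspose_vecMulVec, star_star]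
    rw [mem_unitaryGroup_iff', star_add, star_one, star_smul, hst, star_div₀, hvs, add_mul, one_mul,
      mul_add, mul_one, smul_mul_smul_comm, hsq, smul_smul, add_assoc, ← add_smul, ← add_smul]
    convert add_zero (1 : Matrix (Fin (N + 1)) (Fin (N + 1)) ℂ)
    rw [smul_eq_zero]
    left
    simp only [star_sub, star_one, Complex.star_def]
    field_simp
    linear_combination hw'
  rw [mem_specialUnitaryGroup_iff]
  refine ⟨mul_mem hrefl hdiag, ?_⟩
  rw [complexReflection, det_mul, det_diagonal, prod_update_of_mem (mem_univ _)]
  have : det (1 + ((w - 1) / (star v ⬝ᵥ v)) • vecMulVec v (star v)) = w := by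
    rw [← smul_vecMulVec, vecMulVec_eq Unit, det_one_add_replicateCol_mul_replicateRow,
      dotProduct_smul, smul_eq_mul, div_mul_cancel₀ _ hv]
    ring
  rw [this]
  simp [mul_comm w, hw']

/-- A family of special unitary matrices parametrised by a cube. -/
noncomputable def suFamily {N : ℕ} (c : ℝ) (a b : Fin N → ℝ) :
    specialUnitaryGroup (Fin (N + 1)) ℂ :=
  ⟨complexReflection (unitPhase (c + ∑ i, b i)) (phaseVector a b),
    complexReflection_mem (norm_unitPhase _) (star_phaseVector_dotProduct_ne_zero a b)⟩

theorem suFamily_congr {N : ℕ} {c c' : ℝ} {a b b' : Fin N → ℝ}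
    (h : unitPhase (c' + ∑ i, b' i) = unitPhase (c + ∑ i, b i)) (p : ℂ) (hp : ‖p‖ = 1)
    (hv : ∀ j, cubeCollapse N a j = 0 ∨
      unitPhase (partialSum b' j) = p * unitPhase (partialSum b j)) :
    suFamily c' a b' = suFamily c a b := by
  apply Subtype.ext
  change complexReflection _ _ = complexReflection _ _
  rw [h, ← complexReflection_smul _ (phaseVector a b) hp]
  congr 1
  funext j
  rcases hv j with hj | hj
  · simp [phaseVector, hj]
  · simp only [phaseVector, hj, Pi.smul_apply, smul_eq_mul]
    ring

theorem suFamily_one_eq_zero {N : ℕ} (a b : Fin N → ℝ) : suFamily 1 a b = suFamily 0 a b :=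
  suFamily_congr (by rw [unitPhase_add, unitPhase_add, unitPhase_one, unitPhase_zero]) 1 (by simp)
    fun j => Or.inr (one_mul _).symm

theorem partialSum_update {N : ℕ} (b : Fin N → ℝ) (i : Fin N) (r : ℝ) (j : Fin (N + 1)) :
    partialSum (Function.update b i r) j =
      partialSum b j + if i.castSucc < j then r - b i else 0 := by
  rw [← sub_eq_iff_eq_add', partialSum, partialSum, ← sum_sub_distrib,
    sum_eq_single i (fun k _ hk => by simp [hk]) (by simp)]
  split_ifs <;> simp

theorem suFamily_update_one_eq_zero {N : ℕ} (c : ℝ) (a b : Fin N → ℝ) (i : Fin N) :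
    suFamily c a (Function.update b i 1) = suFamily c a (Function.update b i 0) := by
  refine suFamily_congr ?_ 1 (by simp) fun j => Or.inr ?_
  · rw [sum_update_of_mem (mem_univ _), sum_update_of_mem (mem_univ _), ← add_assoc, ← add_assoc,
      unitPhase_add, unitPhase_add, unitPhase_one, unitPhase_add, unitPhase_add, unitPhase_zero]
  · rw [partialSum_update, partialSum_update, one_mul]
    split_ifs
    · rw [sub_eq_add_neg, sub_eq_add_neg]
      simp only [unitPhase_add, unitPhase_one, unitPhase_zero]
    · rfl

theorem suFamily_swap_of_eq_one {N : ℕ} (c : ℝ) (a b : Fin (N + 1) → ℝ) (k : Fin N)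
    (h : a k.succ = 1) :
    suFamily c a (b ∘ swap k.castSucc k.succ) = suFamily c a b := by
  refine suFamily_congr ?_ 1 (by simp) fun j => ?_
  · congr 2
    exact Equiv.sum_comp (swap k.castSucc k.succ) b
  · rcases eq_or_ne j k.succ.castSucc with rfl | hj
    · exact Or.inl (cubeCollapse_castSucc_eq_zero a _ h)
    · refine Or.inr ?_
      rw [one_mul]
      congr 1
      rw [partialSum, partialSum, ← Equiv.sum_comp (swap k.castSucc k.succ)]
      refine sum_congr rfl fun i _ => ?_
      rw [Function.comp_apply, swap_apply_self]
      refine if_congr ?_ rfl rfl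
      rw [ne_eq, Fin.ext_iff] at hj
      rcases eq_or_ne i k.castSucc with rfl | h1
      · rw [swap_apply_left]
        simp only [Fin.lt_def, Fin.val_castSucc, Fin.val_succ] at hj ⊢
        omega
      · rcases eq_or_ne i k.succ with rfl | h2
        · rw [swap_apply_right]
          simp only [Fin.lt_def, Fin.val_castSucc, Fin.val_succ] at hj ⊢
          omega
        · rw [swap_apply_of_ne_of_ne h1 h2]

theorem suFamily_exchange_sum {N : ℕ} (c : ℝ) (b : Fin N → ℝ) (i : Fin N) :
    b i + ∑ k, Function.update b i c k = c + ∑ k, b k := by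
  rw [sum_update_of_mem (mem_univ _), ← sum_add_sum_compl {i} b, sum_singleton,
    ← compl_eq_univ_sdiff]
  ring

theorem suFamily_exchange_of_eq_one {N : ℕ} (c : ℝ) (a b : Fin (N + 1) → ℝ) (h : a 0 = 1) :
    suFamily (b 0) a (Function.update b 0 c) = suFamily c a b := by
  refine suFamily_congr (by rw [suFamily_exchange_sum]) (unitPhase (c - b 0))
    (norm_unitPhase _) fun j => ?_
  rcases eq_or_ne j 0 with rfl | hj
  · exact Or.inl (cubeCollapse_castSucc_eq_zero a 0 h)
  · refine Or.inr ?_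
    rw [partialSum_update, if_pos (by simpa [Fin.pos_iff_ne_zero] using hj), unitPhase_add,
      mul_comm]

theorem suFamily_exchange_of_eq_zero {N : ℕ} (c : ℝ) (a b : Fin N → ℝ) (i : Fin N)
    (h : a i = 0) : suFamily (b i) a (Function.update b i c) = suFamily c a b := by
  refine suFamily_congr (by rw [suFamily_exchange_sum]) 1 (by simp) fun j => ?_
  by_cases hj : i.castSucc < j
  · exact Or.inl (cubeCollapse_eq_zero_of_lt a i h j hj)
  · refine Or.inr ?_
    rw [partialSum_update, if_neg hj, add_zero, one_mul]

end SpecialUnitaryFamily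

section SpecialUnitaryCube

open Finset Equiv Matrix ComplexConjugate

/-- The family `suFamily` as a function on the cube with coordinates indexed by the disjoint union
of a point and two copies of `Fin N`. -/
noncomputable def suCube {N : ℕ} (x : Option (Fin N ⊕ Fin N) → ℝ) :
    specialUnitaryGroup (Fin (N + 1)) ℂ :=
  suFamily (x none) (fun i => x (some (.inl i))) (fun i => x (some (.inr i)))

theorem suCube_exchange {N : ℕ} (x : Option (Fin N ⊕ Fin N) → ℝ) (i k : Fin N) (r : ℝ) :
    suCube (Function.update (x ∘ swap none (some (.inr i))) (some (.inl k)) r) =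
      suFamily (x (some (.inr i))) (fun i => Function.update x (some (.inl k)) r (some (.inl i)))
        (Function.update (fun i => x (some (.inr i))) i (x none)) := by
  rw [suCube]
  congr 1
  funext j
  rcases eq_or_ne j i with rfl | hj
  · simp
  · simp [swap_apply_of_ne_of_ne, hj]

theorem facesCancel_suCube {N : ℕ} (k : Option (Fin N ⊕ Fin N)) :
    FacesCancel (suCube : (Option (Fin N ⊕ Fin N) → ℝ) → _) k := by
  rcases k with _ | k | k
  · refine Or.inl fun u => ?_
    simpa [suCube] using suFamily_one_eq_zero _ _
  · refine Or.inr fun ε hε => ?_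
    rcases hε with rfl | rfl
    · refine ⟨none, some (.inr k), by simp, by simp, by simp, fun u => ?_⟩
      rw [suCube_exchange, suFamily_exchange_of_eq_zero _ _ (fun i => u (some (.inr i))) k (by simp)]
      simp [suCube]
    · cases N with
      | zero => exact k.elim0
      | succ N =>
        refine Fin.cases ?_ (fun k => ?_) k
        · refine ⟨none, some (.inr 0), by simp, by simp, by simp, fun u => ?_⟩
          rw [suCube_exchange,
            suFamily_exchange_of_eq_one _ _ (fun i => u (some (.inr i))) (by simp)]
          simp [suCube]
        · refine ⟨some (.inr k.castSucc), some (.inr k.succ), by simp [Fin.ext_iff], by simp,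
            by simp, fun u => ?_⟩
          have h := suFamily_swap_of_eq_one (u none)
            (fun i => Function.update u (some (.inl k.succ)) 1 (some (.inl i)))
            (fun i => u (some (.inr i))) k (by simp)
          rw [suCube]
          refine Eq.trans ?_ (h.trans ?_)
          · congr 1
            funext j
            simp only [Function.update_apply, Function.comp_apply]
            rcases eq_or_ne j k.castSucc with rfl | h1
            · simp
            · rcases eq_or_ne j k.succ with rfl | h2
              · simp
              · simp [swap_apply_of_ne_of_ne, h1, h2]
          · simp [suCube]
  · refine Or.inl fun u => ?_
    have h := suFamily_update_one_eq_zero (u none) (fun i => u (some (.inl i)))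
      (fun i => u (some (.inr i))) k
    rw [suCube, suCube]
    convert h using 2
    all_goals first | rfl | (funext j; simp [Function.update_apply])

theorem FacesCancel.comp_equiv {ι κ X : Type*} [DecidableEq ι] [DecidableEq κ]
    {f : (ι → ℝ) → X} {e : κ ≃ ι} {k : κ} (h : FacesCancel f (e k)) :
    FacesCancel (fun u : κ → ℝ => f (u ∘ e.symm)) k := by
  have hup : ∀ (u : κ → ℝ) (r : ℝ), Function.update u k r ∘ e.symm =
      Function.update (u ∘ e.symm) (e k) r := by
    intro u r
    rw [Function.update_comp_equiv, Equiv.symm_symm]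
  simp only [FacesCancel, hup]
  refine h.imp (fun h u => h _) fun h ε hε => ?_
  obtain ⟨p, q, hpq, hp, hq, h⟩ := h ε hε
  refine ⟨e.symm p, e.symm q, by simpa using hpq, by simpa [Equiv.eq_symm_apply] using hp,
    by simpa [Equiv.eq_symm_apply] using hq, fun u => ?_⟩
  rw [← h]
  congr 2
  funext i
  simp only [Function.comp_apply, Equiv.swap_apply_def, EmbeddingLike.apply_eq_iff_eq]
  split_ifs <;> simp_all

theorem contDiff_unitPhase {r : WithTop ℕ∞} : ContDiff ℝ r unitPhase := by
  unfold unitPhase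
  have : ContDiff ℝ r fun t : ℝ => (((2 * Real.pi * t : ℝ) : ℂ)) :=
    Complex.ofRealCLM.contDiff.comp (contDiff_const.mul contDiff_id)
  exact (this.mul contDiff_const).cexp

theorem contDiff_partialSum {N : ℕ} {r : WithTop ℕ∞} (j : Fin (N + 1)) :
    ContDiff ℝ r fun b : Fin N → ℝ => partialSum b j := by
  unfold partialSum
  refine ContDiff.sum fun i _ => ?_
  split_ifs <;> fun_prop

theorem continuous_suCube {N : ℕ} :
    Continuous (suCube : (Option (Fin N ⊕ Fin N) → ℝ) → specialUnitaryGroup (Fin (N + 1)) ℂ) := by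
  have hl : Continuous fun x : Option (Fin N ⊕ Fin N) → ℝ => fun i => x (some (.inl i)) := by
    fun_prop
  have hr : Continuous fun x : Option (Fin N ⊕ Fin N) → ℝ => fun i => x (some (.inr i)) := by
    fun_prop
  have hphase : Continuous unitPhase := (contDiff_unitPhase (r := 0)).continuous
  have hw : Continuous fun x : Option (Fin N ⊕ Fin N) → ℝ =>
      unitPhase (x none + ∑ i, x (some (.inr i))) := by fun_prop
  have hv : Continuous fun x : Option (Fin N ⊕ Fin N) → ℝ =>
      phaseVector (fun i => x (some (.inl i))) (fun i => x (some (.inr i))) := by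
    refine continuous_pi fun j => ?_
    refine (Complex.continuous_ofReal.comp ?_).mul (hphase.comp ?_)
    · exact (continuous_apply j).comp ((contDiff_cubeCollapse (r := 0) N).continuous.comp hl)
    · exact (contDiff_partialSum (r := 0) j).continuous.comp hr
  refine Continuous.subtype_mk ?_ _
  unfold complexReflection
  refine Continuous.matrix_mul ?_ ?_
  · have hdiv := (hw.sub (continuous_const (y := (1 : ℂ)))).div (hv.star.dotProduct hv) fun x =>
      star_phaseVector_dotProduct_ne_zero _ _
    exact continuous_const.add (hdiv.smul (hv.matrix_vecMulVec hv.star))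
  · exact (continuous_const.update _ (Complex.continuous_conj.comp hw)).matrix_diagonal

theorem partialSum_zero {N : ℕ} (b : Fin N → ℝ) : partialSum b 0 = 0 := by
  simp [partialSum]

/-- The weight `(cubeCollapse a 0) * (cubeCollapse a j)`, normalised by the sum of squares. -/
noncomputable def columnWeight {N : ℕ} (a : Fin N → ℝ) (j : Fin (N + 1)) : ℝ :=
  cubeCollapse N a 0 * cubeCollapse N a j / ∑ k, cubeCollapse N a k ^ 2

/-- The first column of `suCube`, as a point of the unit sphere. -/
noncomputable def sphereCube {N : ℕ} (x : Option (Fin N ⊕ Fin N) → ℝ) :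
    EuclideanSpace ℂ (Fin (N + 1)) :=
  WithLp.toLp 2 fun j => (Pi.single 0 1 : Fin (N + 1) → ℂ) j +
    (unitPhase (x none + ∑ i, x (some (.inr i))) - 1) *
      (columnWeight (fun i => x (some (.inl i))) j *
        unitPhase (partialSum (fun i => x (some (.inr i))) j))

theorem suCube_mulVec_single {N : ℕ} (x : Option (Fin (N + 1) ⊕ Fin (N + 1)) → ℝ) :
    (suCube x : Matrix (Fin (N + 2)) (Fin (N + 2)) ℂ) *ᵥ Pi.single 0 1 = (sphereCube x).ofLp := by
  change complexReflection _ _ *ᵥ _ = _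
  have h : diagonal (Function.update (1 : Fin (N + 2) → ℂ) (Fin.last (N + 1))
      (conj (unitPhase (x none + ∑ i, x (some (.inr i)))))) *ᵥ Pi.single 0 1 = Pi.single 0 1 := by
    rw [mulVec_single_one]
    funext j
    refine Fin.cases ?_ (fun j => ?_) j
    · simp [Fin.ext_iff]
    · rw [col_apply, diagonal_apply_ne _ (Fin.succ_ne_zero j),
        Pi.single_eq_of_ne (Fin.succ_ne_zero j)]
  rw [complexReflection, ← mulVec_mulVec, h, add_mulVec, one_mulVec, smul_mulVec,
    star_phaseVector_dotProduct]
  funext j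
  have hconj : conj (phaseVector (fun i => x (some (.inl i))) (fun i => x (some (.inr i))) 0) =
      cubeCollapse (N + 1) (fun i => x (some (.inl i))) 0 := by
    simp [phaseVector, partialSum_zero, unitPhase_zero]
  simp only [sphereCube, Pi.add_apply, Pi.smul_apply, mulVec_single_one, col_apply,
    vecMulVec_apply, Pi.star_apply, Complex.star_def, hconj, smul_eq_mul, columnWeight]
  rw [phaseVector]
  push_cast
  ring

theorem contDiff_sphereCube {N : ℕ} {r : WithTop ℕ∞} : ContDiff ℝ r
    (sphereCube : (Option (Fin N ⊕ Fin N) → ℝ) → EuclideanSpace ℂ (Fin (N + 1))) := by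
  have hl : ContDiff ℝ r fun x : Option (Fin N ⊕ Fin N) → ℝ => fun i => x (some (.inl i)) := by
    fun_prop
  have hr : ContDiff ℝ r fun x : Option (Fin N ⊕ Fin N) → ℝ => fun i => x (some (.inr i)) := by
    fun_prop
  have hw : ContDiff ℝ r fun x : Option (Fin N ⊕ Fin N) → ℝ =>
      x none + ∑ i, x (some (.inr i)) := by fun_prop
  have hc : ∀ j, ContDiff ℝ r fun x : Option (Fin N ⊕ Fin N) → ℝ =>
      cubeCollapse N (fun i => x (some (.inl i))) j := fun j =>
    contDiff_pi.1 ((contDiff_cubeCollapse N).comp hl) j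
  have hcol : ∀ j, ContDiff ℝ r fun x : Option (Fin N ⊕ Fin N) → ℝ =>
      columnWeight (fun i => x (some (.inl i))) j := fun j =>
    ((hc 0).mul (hc j)).div (ContDiff.sum fun k _ => (hc k).pow 2) fun x =>
      (sum_sq_cubeCollapse_pos _).ne'
  refine PiLp.contDiff_toLp.comp (contDiff_pi.2 fun j => ?_)
  exact contDiff_const.add (((contDiff_unitPhase.comp hw).sub contDiff_const).mul
    ((Complex.ofRealCLM.contDiff.comp (hcol j)).mul
      (contDiff_unitPhase.comp ((contDiff_partialSum j).comp hr))))

end SpecialUnitaryCube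

section SphereCubeImmersion

open Finset ComplexConjugate

theorem hasDerivAt_unitPhase (t : ℝ) :
    HasDerivAt unitPhase (2 * Real.pi * Complex.I * unitPhase t) t := by
  have h : HasDerivAt unitPhase _ t :=
    ((((hasDerivAt_id t).const_mul (2 * Real.pi)).ofReal_comp).mul_const Complex.I).cexp
  refine h.congr_deriv ?_
  simp only [unitPhase, id, mul_one]
  push_cast
  ring

theorem cubeCollapse_pos {N : ℕ} (a : Fin N → ℝ) (ha : ∀ i, a i ∈ Set.Ioo (0 : ℝ) 1)
    (j : Fin (N + 1)) : 0 < cubeCollapse N a j := by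
  induction N with
  | zero => simp [cubeCollapse]
  | succ N ih =>
    rw [cubeCollapse]
    refine Fin.cases ?_ (fun j => ?_) j
    · simpa using (ha 0).2
    · simpa using mul_pos (ha 0).1 (ih (Fin.tail a) (fun i => ha i.succ) j)

theorem eq_zero_of_hasDerivAt_cubeCollapse {N : ℕ} (a α : Fin N → ℝ) (ha : ∀ i, a i ≠ 0)
    (h : ∀ j, HasDerivAt (fun s : ℝ => cubeCollapse N (a + s • α) j) 0 0) : α = 0 := by
  induction N with
  | zero => exact Subsingleton.elim _ _
  | succ N ih =>
    have h0 : α 0 = 0 := by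
      have h1 := h 0
      simp only [cubeCollapse, Fin.cons_zero, Pi.add_apply, Pi.smul_apply, smul_eq_mul] at h1
      have h2 := (((hasDerivAt_id (0 : ℝ)).mul_const (α 0)).const_add (a 0)).const_sub 1
      simpa using h1.unique h2
    have ht : Fin.tail α = 0 := by
      refine ih (Fin.tail a) _ (fun i => ha i.succ) fun j => ?_
      have h1 := (h j.succ).const_mul (a 0)⁻¹
      rw [mul_zero] at h1
      refine h1.congr_of_eventuallyEq (.of_forall fun s => ?_)
      simp only [cubeCollapse, Fin.cons_succ, Pi.add_apply, Pi.smul_apply, smul_eq_mul, h0,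
        mul_zero, add_zero]
      rw [inv_mul_cancel_left₀ (ha 0)]
      rfl
    funext i
    exact Fin.cases h0 (fun i => congrFun ht i) i

theorem partialSum_add_smul {N : ℕ} (b β : Fin N → ℝ) (s : ℝ) (j : Fin (N + 1)) :
    partialSum (b + s • β) j = partialSum b j + s * partialSum β j := by
  rw [partialSum, partialSum, partialSum, mul_sum, ← sum_add_distrib]
  refine sum_congr rfl fun i _ => ?_
  split_ifs <;> simp

theorem partialSum_succ {N : ℕ} (b : Fin N → ℝ) (i : Fin N) :
    partialSum b i.succ = partialSum b i.castSucc + b i := by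
  rw [← sub_eq_iff_eq_add', partialSum, partialSum, ← sum_sub_distrib,
    sum_eq_single i (fun k _ hk => ?_) (by simp)]
  · simp
  · have : k.castSucc < i.succ ↔ k.castSucc < i.castSucc := by
      simp only [Fin.lt_def, Fin.val_castSucc, Fin.val_succ]
      have := Fin.val_ne_of_ne hk
      omega
    simp only [this, sub_self]

theorem eq_zero_of_fderiv_sphereCube_eq_zero {N : ℕ} {x ξ : Option (Fin N ⊕ Fin N) → ℝ}
    (ha : ∀ i, x (some (.inl i)) ∈ Set.Ioo (0 : ℝ) 1)
    (hw : unitPhase (x none + ∑ i, x (some (.inr i))) ≠ 1)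
    (h : fderiv ℝ sphereCube x ξ = 0) : ξ = 0 := by
  set a : Fin N → ℝ := fun i => x (some (.inl i)) with ha_def
  set b : Fin N → ℝ := fun i => x (some (.inr i)) with hb_def
  set α : Fin N → ℝ := fun i => ξ (some (.inl i)) with hα_def
  set β : Fin N → ℝ := fun i => ξ (some (.inr i)) with hβ_def
  set S : ℝ := x none + ∑ i, b i with hS
  set γ : ℝ := ξ none + ∑ i, β i with hγ
  have hline : HasDerivAt (fun s : ℝ => x + s • ξ) ξ 0 := by
    simpa using ((hasDerivAt_id (0 : ℝ)).smul_const ξ).const_add x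
  have hαline : HasDerivAt (fun s : ℝ => a + s • α) α 0 := by
    simpa using ((hasDerivAt_id (0 : ℝ)).smul_const α).const_add a
  have hG : HasDerivAt (fun s : ℝ => sphereCube (x + s • ξ)) 0 0 := by
    have hd : DifferentiableAt ℝ (sphereCube (N := N)) (x + (0 : ℝ) • ξ) :=
      (contDiff_sphereCube (r := 1)).differentiable one_ne_zero _
    have := hd.hasFDerivAt.comp_hasDerivAt (0 : ℝ) hline
    rwa [zero_smul, add_zero, h] at this
  have hr : ∀ j, ∃ ρ : ℝ, HasDerivAt (fun s : ℝ => cubeCollapse N (a + s • α) j) ρ 0 := fun j =>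
    ⟨_, (((contDiff_pi.1 (contDiff_cubeCollapse (r := 1) N) j).differentiable
      one_ne_zero _).hasFDerivAt.comp_hasDerivAt (0 : ℝ) hαline)⟩
  choose ρ hρ using hr
  have hT : ∃ τ : ℝ, HasDerivAt (fun s : ℝ => cubeCollapse N (a + s • α) 0 /
      ∑ k, cubeCollapse N (a + s • α) k ^ 2) τ 0 :=
    ⟨_, (hρ 0).div (HasDerivAt.fun_sum fun k _ => (hρ k).pow 2) (sum_sq_cubeCollapse_pos _).ne'⟩
  obtain ⟨τ, hτ⟩ := hT
  set T : ℝ := cubeCollapse N a 0 / ∑ k, cubeCollapse N a k ^ 2 with hTdef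
  have hT0 : T ≠ 0 := (div_pos (cubeCollapse_pos a ha 0) (sum_sq_cubeCollapse_pos a)).ne'
  have hwd : HasDerivAt (fun s : ℝ => unitPhase (S + s * γ))
      (γ * (2 * Real.pi * Complex.I * unitPhase S)) 0 := by
    have h1 : HasDerivAt (fun s : ℝ => S + s * γ) γ 0 := by
      simpa using ((hasDerivAt_id (0 : ℝ)).mul_const γ).const_add S
    have h2 := (hasDerivAt_unitPhase (S + 0 * γ)).scomp 0 h1
    simpa [Function.comp_def] using h2
  have hBd : ∀ j, HasDerivAt (fun s : ℝ => unitPhase (partialSum b j + s * partialSum β j))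
      (partialSum β j * (2 * Real.pi * Complex.I * unitPhase (partialSum b j))) 0 := by
    intro j
    have h1 : HasDerivAt (fun s : ℝ => partialSum b j + s * partialSum β j)
        (partialSum β j) 0 := by
      simpa using ((hasDerivAt_id (0 : ℝ)).mul_const (partialSum β j)).const_add (partialSum b j)
    have h2 := (hasDerivAt_unitPhase (partialSum b j + 0 * partialSum β j)).scomp 0 h1
    simpa [Function.comp_def] using h2
  have hcoord : ∀ j, γ * (2 * Real.pi * Complex.I * unitPhase S) * (T * cubeCollapse N a j) +
      (unitPhase S - 1) * ((τ * cubeCollapse N a j + T * ρ j) +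
        T * cubeCollapse N a j * (partialSum β j * (2 * Real.pi * Complex.I))) = 0 := by
    intro j
    have h1 : HasDerivAt (fun s : ℝ => (sphereCube (x + s • ξ)).ofLp j) 0 0 := by
      have := (PiLp.proj (𝕜 := ℝ) 2 (fun _ : Fin (N + 1) => ℂ) j).hasFDerivAt.comp_hasDerivAt
        (0 : ℝ) hG
      simpa [Function.comp_def] using this
    have h2 := ((hwd.sub_const 1).fun_mul (((hτ.fun_mul (hρ j)).ofReal_comp).fun_mul (hBd j))).const_add
      ((Pi.single 0 1 : Fin (N + 1) → ℂ) j)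
    have h3 := h1.unique (h2.congr_of_eventuallyEq (.of_forall fun s => ?_))
    · simp only [zero_mul, zero_smul, add_zero, ← hTdef] at h3
      have hne := unitPhase_ne_zero (partialSum b j)
      rw [← mul_eq_zero_iff_right hne, h3]
      push_cast
      ring
    · have hw' : (x + s • ξ) none + ∑ i, (x + s • ξ) (some (.inr i)) = S + s * γ := by
        simp only [hS, hγ, Pi.add_apply, Pi.smul_apply, smul_eq_mul, sum_add_distrib, mul_add,
          mul_sum, hb_def, hβ_def]
        ring
      have hcol : columnWeight (a + s • α) j = cubeCollapse N (a + s • α) 0 /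
          (∑ k, cubeCollapse N (a + s • α) k ^ 2) * cubeCollapse N (a + s • α) j := by
        rw [columnWeight]
        ring
      simp only [← partialSum_add_smul, sphereCube, hw']
      change _ + _ * (((columnWeight (a + s • α) j : ℝ) : ℂ) * _) = _
      rw [hcol]
      rfl
  have hu : unitPhase S - 1 ≠ 0 := sub_ne_zero.2 hw
  obtain ⟨q, hq⟩ : ∃ q : ℂ, γ * (2 * Real.pi * Complex.I * unitPhase S) = (unitPhase S - 1) * q :=
    ⟨_, (mul_div_cancel₀ _ hu).symm⟩
  have hcoord' : ∀ j, q * ((T * cubeCollapse N a j : ℝ) : ℂ) +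
      (((τ * cubeCollapse N a j + T * ρ j : ℝ) : ℂ) +
        ((T * cubeCollapse N a j * (partialSum β j * (2 * Real.pi)) : ℝ) : ℂ) * Complex.I) = 0 := by
    intro j
    have h1 := hcoord j
    rw [hq] at h1
    rw [← mul_eq_zero_iff_left hu, ← h1]
    push_cast
    ring
  have hre : ∀ j, q.re * (T * cubeCollapse N a j) + (τ * cubeCollapse N a j + T * ρ j) = 0 := by
    intro j
    simpa using congrArg Complex.re (hcoord' j)
  have him : ∀ j, q.im * (T * cubeCollapse N a j) +
      T * cubeCollapse N a j * (partialSum β j * (2 * Real.pi)) = 0 := by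
    intro j
    simpa using congrArg Complex.im (hcoord' j)
  have hTr : ∀ j, T * cubeCollapse N a j ≠ 0 := fun j =>
    mul_ne_zero hT0 (cubeCollapse_pos a ha j).ne'
  have hqim : q.im = 0 := by
    have := him 0
    rw [partialSum_zero, zero_mul, mul_zero, add_zero] at this
    exact (mul_eq_zero.1 this).resolve_right (hTr 0)
  have hβj : ∀ j, partialSum β j = 0 := by
    intro j
    have := him j
    rw [hqim, zero_mul, zero_add] at this
    simpa [hTr j, Real.pi_ne_zero] using (mul_eq_zero.1 this).resolve_left (hTr j)
  have hβ0 : β = 0 := by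
    funext i
    have := partialSum_succ β i
    rw [hβj, hβj, zero_add] at this
    exact this.symm
  have hsumρ : ∑ j, ρ j = 0 := by
    have h1 := HasDerivAt.fun_sum (u := univ) fun j _ => hρ j
    simp only [sum_cubeCollapse] at h1
    exact h1.unique (hasDerivAt_const _ _)
  have hτq : q.re * T + τ = 0 := by
    have h1 := sum_congr rfl fun j (_ : j ∈ univ) => hre j
    simp only [sum_add_distrib, ← mul_sum, sum_cubeCollapse, hsumρ, mul_one, mul_zero, add_zero,
      sum_const_zero] at h1
    exact h1
  have hρ0 : ∀ j, ρ j = 0 := by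
    intro j
    refine (mul_eq_zero.1 ?_).resolve_left hT0
    linear_combination hre j - cubeCollapse N a j * hτq
  have hα0 : α = 0 := eq_zero_of_hasDerivAt_cubeCollapse a α (fun i => (ha i).1.ne')
    fun j => by simpa only [hρ0] using hρ j
  have hτ0 : τ = 0 := by
    simp only [hα0, smul_zero, add_zero] at hτ
    exact hτ.unique (hasDerivAt_const _ _)
  have hq0 : q = 0 := by
    refine Complex.ext ?_ hqim
    rw [hτ0, add_zero] at hτq
    exact (mul_eq_zero.1 hτq).resolve_right hT0
  have hγ0 : γ = 0 := by
    rw [hq0, mul_zero] at hq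
    simpa [Real.pi_ne_zero, unitPhase_ne_zero] using hq
  funext o
  rcases o with _ | i | i
  · simpa [hγ, hβ0] using hγ0
  · exact congrFun hα0 i
  · exact congrFun hβ0 i

end SphereCubeImmersion

section SphereCubeDegree

open Finset

theorem exists_continuousAlternatingMap_ne_zero {E : Type*} [NormedAddCommGroup E]
    [NormedSpace ℝ E] [FiniteDimensional ℝ E] {m : ℕ} (hE : Module.finrank ℝ E = m + 1) :
    ∃ D : E [⋀^Fin (m + 1)]→L[ℝ] ℝ, ∀ v : Fin (m + 1) → E, LinearIndependent ℝ v → D v ≠ 0 := by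
  let B := Module.finBasisOfFinrankEq ℝ E hE
  have hcont : Continuous fun v : Fin (m + 1) → E => B.det v := by
    simp only [Module.Basis.det_apply]
    refine Continuous.matrix_det (continuous_pi fun i => continuous_pi fun j => ?_)
    exact (B.coord i).continuous_of_finiteDimensional.comp (continuous_apply j)
  refine ⟨{ B.det with cont := hcont }, fun v hv => ?_⟩
  exact ((Module.Basis.is_basis_iff_det B).1
    ⟨hv, hv.span_eq_top_of_card_eq_finrank (by simp [hE])⟩).ne_zero

theorem sphericalJacobian_ne_zero {E : Type*} [NormedAddCommGroup E] [InnerProductSpace ℝ E]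
    {m : ℕ} {D : E [⋀^Fin (m + 1)]→L[ℝ] ℝ} (hD : ∀ v, LinearIndependent ℝ v → D v ≠ 0)
    {G : (Fin m → ℝ) → E} {x : Fin m → ℝ} (hG : DifferentiableAt ℝ G x) (hGn : ∀ y, ‖G y‖ = 1)
    (hinj : ∀ ξ, fderiv ℝ G x ξ = 0 → ξ = 0) : sphericalJacobian D G x ≠ 0 := by
  refine hD _ (linearIndependent_finCons.2 ⟨?_, fun hmem => ?_⟩)
  · have h := (Pi.basisFun ℝ (Fin m)).linearIndependent.map' (fderiv ℝ G x).toLinearMap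
      (LinearMap.ker_eq_bot'.2 hinj)
    have hv : (fderiv ℝ G x).toLinearMap ∘ Pi.basisFun ℝ (Fin m) =
        fun i => fderiv ℝ G x (Pi.single i 1) := by
      funext i
      simp
    rwa [hv] at h
  · have hle : Submodule.span ℝ (Set.range fun i => fderiv ℝ G x (Pi.single i 1)) ≤
        (Submodule.span ℝ {G x})ᗮ := by
      rw [Submodule.span_le]
      rintro _ ⟨i, rfl⟩
      exact Submodule.mem_orthogonal_singleton_iff_inner_right.2
        (fderiv_inner_eq_zero_of_norm_eq_one hG (.of_forall hGn) _)
    have h := Submodule.mem_orthogonal_singleton_iff_inner_right.1 (hle hmem)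
    rw [inner_self_eq_zero (𝕜 := ℝ)] at h
    simpa [h] using hGn x

theorem IsPreconnected.forall_pos_or_forall_neg {X : Type*} [TopologicalSpace X] {U : Set X}
    (hU : IsPreconnected U) {J : X → ℝ} (hJ : ContinuousOn J U) (h0 : ∀ x ∈ U, J x ≠ 0) :
    (∀ x ∈ U, 0 < J x) ∨ ∀ x ∈ U, J x < 0 := by
  by_contra! h
  obtain ⟨⟨x, hx, hx'⟩, y, hy, hy'⟩ := h
  obtain ⟨z, hz, hz0⟩ := hU.intermediate_value hx hy hJ ⟨hx', hy'⟩
  exact h0 z hz hz0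

/-- The coordinates of `sphereCube`, listed by a finite ordinal. -/
noncomputable def sphereCubeFin {N m : ℕ} (e : Fin m ≃ Option (Fin N ⊕ Fin N)) (u : Fin m → ℝ) :
    EuclideanSpace ℂ (Fin (N + 1)) :=
  sphereCube (u ∘ e.symm)

variable {N m : ℕ} (e : Fin m ≃ Option (Fin N ⊕ Fin N))

theorem contDiff_sphereCubeFin {r : WithTop ℕ∞} : ContDiff ℝ r (sphereCubeFin e) :=
  contDiff_sphereCube.comp (contDiff_pi.2 fun o => contDiff_apply ℝ ℝ (e.symm o))

theorem fderiv_sphereCubeFin (u ξ : Fin m → ℝ) : fderiv ℝ (sphereCubeFin e) u ξ =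
    fderiv ℝ sphereCube (u ∘ e.symm) (ξ ∘ e.symm) := by
  let L : (Fin m → ℝ) →L[ℝ] (Option (Fin N ⊕ Fin N) → ℝ) :=
    ContinuousLinearMap.pi fun o => ContinuousLinearMap.proj (e.symm o)
  have hd : DifferentiableAt ℝ (sphereCube (N := N)) (L u) :=
    (contDiff_sphereCube (r := 1)).differentiable one_ne_zero _
  exact congrArg (fun A => A ξ) (hd.hasFDerivAt.comp u L.hasFDerivAt).fderiv

/-- The exponent of the eigenvalue of `suCube`. -/
def phaseSum (u : Fin m → ℝ) : ℝ := u (e.symm none) + ∑ i, u (e.symm (some (.inr i)))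

theorem sphericalJacobian_sphereCubeFin_add_int
    (D : EuclideanSpace ℂ (Fin (N + 1)) [⋀^Fin (m + 1)]→L[ℝ] ℝ) (u : Fin m → ℝ) (k : ℤ) :
    sphericalJacobian D (sphereCubeFin e) (u + Pi.single (e.symm none) (k : ℝ)) =
      sphericalJacobian D (sphereCubeFin e) u := by
  have h : ∀ y, sphereCubeFin e (y + Pi.single (e.symm none) (k : ℝ)) = sphereCubeFin e y := by
    intro y
    have h1 : ∀ o : Fin N ⊕ Fin N,
        ((y + Pi.single (e.symm none) (k : ℝ)) ∘ e.symm) (some o) = (y ∘ e.symm) (some o) := by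
      simp
    have h2 : unitPhase (((y + Pi.single (e.symm none) (k : ℝ)) ∘ e.symm) none +
        ∑ i, (y ∘ e.symm) (some (.inr i))) =
        unitPhase ((y ∘ e.symm) none + ∑ i, (y ∘ e.symm) (some (.inr i))) := by
      rw [Function.comp_apply, Pi.add_apply, Pi.single_eq_same, add_right_comm, unitPhase_add _ k,
        unitPhase_intCast, mul_one]
      rfl
    simp only [sphereCubeFin, sphereCube, h1, h2]
  have hf : fderiv ℝ (sphereCubeFin e) (u + Pi.single (e.symm none) (k : ℝ)) =
      fderiv ℝ (sphereCubeFin e) u := by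
    rw [← fderiv_comp_add_right]
    simp only [h]
  rw [sphericalJacobian, sphericalJacobian, h, hf]

theorem sphericalJacobian_sphereCubeFin_eq_zero
    (D : EuclideanSpace ℂ (Fin (N + 1)) [⋀^Fin (m + 1)]→L[ℝ] ℝ) (i : Fin N) (u : Fin m → ℝ)
    (hu : unitPhase (phaseSum e u) = 1) : sphericalJacobian D (sphereCubeFin e) u = 0 := by
  have h : fderiv ℝ (sphereCubeFin e) u (Pi.single (e.symm (some (.inl i))) 1) = 0 := by
    have hd : DifferentiableAt ℝ (sphereCubeFin e)
        (u + (0 : ℝ) • Pi.single (e.symm (some (.inl i))) 1) :=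
      (contDiff_sphereCubeFin (r := 1) e).differentiable one_ne_zero _
    have h1 : HasDerivAt (fun s : ℝ => u + s • Pi.single (e.symm (some (.inl i))) (1 : ℝ))
        (Pi.single (e.symm (some (.inl i))) 1) 0 := by
      simpa using ((hasDerivAt_id (0 : ℝ)).smul_const
        (Pi.single (e.symm (some (.inl i))) (1 : ℝ))).const_add u
    have h2 := hd.hasFDerivAt.comp_hasDerivAt (0 : ℝ) h1
    rw [zero_smul, add_zero] at h2
    refine h2.unique ((hasDerivAt_const (0 : ℝ) (sphereCubeFin e u)).congr_of_eventuallyEq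
      (.of_forall fun s => ?_))
    have h3 : ∀ o : Option (Fin N), ((u + s • Pi.single (e.symm (some (.inl i))) (1 : ℝ)) ∘ e.symm)
        (o.map .inr) = (u ∘ e.symm) (o.map .inr) := by
      rintro (_ | o) <;> simp
    have h4 := h3 none
    have h5 := fun i => h3 (some i)
    simp only [Option.map_none, Option.map_some] at h4 h5
    have h6 : unitPhase ((u ∘ e.symm) none + ∑ i, (u ∘ e.symm) (some (.inr i))) = 1 := hu
    simp only [Function.comp_apply (f := sphereCubeFin e), sphereCubeFin, sphereCube, h4, h5, h6,
      sub_self, zero_mul]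
  refine D.map_coord_zero (Fin.succ (e.symm (some (.inl i)))) ?_
  simpa using h

theorem exists_sphericalJacobian_sphereCubeFin_pos (i₀ : Fin N)
    (hn : ∀ x : Option (Fin N ⊕ Fin N) → ℝ, ‖sphereCube x‖ = 1) :
    ∃ D : EuclideanSpace ℂ (Fin (N + 1)) [⋀^Fin (m + 1)]→L[ℝ] ℝ, ∃ δ > 0,
      (∀ x ∈ Set.pi Set.univ (fun _ : Fin m => Set.Ioo (0 : ℝ) 1),
        0 ≤ sphericalJacobian D (sphereCubeFin e) x) ∧
      ∀ x ∈ Set.pi Set.univ (fun _ : Fin m => Set.Ioo (0 : ℝ) 1), (∀ i, x i < δ) →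
        0 < sphericalJacobian D (sphereCubeFin e) x := by
  have hm : m = N + N + 1 := by
    simpa using Fintype.card_congr e
  have hE : Module.finrank ℝ (EuclideanSpace ℂ (Fin (N + 1))) = m + 1 := by
    rw [(WithLp.linearEquiv 2 ℝ (Fin (N + 1) → ℂ)).finrank_eq, Module.finrank_pi_fintype]
    simp only [Complex.finrank_real_complex, sum_const, card_univ, Fintype.card_fin, smul_eq_mul]
    omega
  obtain ⟨D₀, hD₀⟩ := exists_continuousAlternatingMap_ne_zero hE
  let U : Set (Fin m → ℝ) := (⋂ i : Fin N,
    (LinearMap.proj (R := ℝ) (φ := fun _ : Fin m => ℝ) (e.symm (some (.inl i)))) ⁻¹' Set.Ioo 0 1) ∩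
    (LinearMap.proj (R := ℝ) (φ := fun _ : Fin m => ℝ) (e.symm none) +
      ∑ i : Fin N, LinearMap.proj (R := ℝ) (φ := fun _ : Fin m => ℝ) (e.symm (some (.inr i)))) ⁻¹'
        Set.Ioo 0 1
  have hU : ∀ u, u ∈ U ↔ (∀ i : Fin N, u (e.symm (some (.inl i))) ∈ Set.Ioo (0 : ℝ) 1) ∧
      phaseSum e u ∈ Set.Ioo (0 : ℝ) 1 := by
    intro u
    simp [U, phaseSum]
  have hUconv : Convex ℝ U := (convex_iInter fun i => (convex_Ioo 0 1).linear_preimage _).inter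
    ((convex_Ioo 0 1).linear_preimage _)
  have hphase : ∀ t : ℝ, t ∈ Set.Ioo (0 : ℝ) 1 → unitPhase t ≠ 1 := by
    intro t ht h
    rw [unitPhase, Complex.exp_eq_one_iff] at h
    obtain ⟨k, hk⟩ := h
    have hk' : (t : ℂ) = k := by
      have : (2 * Real.pi * Complex.I : ℂ) ≠ 0 := by simp [Real.pi_ne_zero]
      refine mul_right_cancel₀ this ?_
      rw [← hk]
      push_cast
      ring
    have hk2 : t = k := by exact_mod_cast hk'
    rw [hk2] at ht
    have h1 : (0 : ℤ) < k := by exact_mod_cast ht.1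
    have h2 : k < (1 : ℤ) := by exact_mod_cast ht.2
    omega
  have hne : ∀ u ∈ U, sphericalJacobian D₀ (sphereCubeFin e) u ≠ 0 := by
    intro u hu
    rw [hU] at hu
    refine sphericalJacobian_ne_zero hD₀
      ((contDiff_sphereCubeFin (r := 1) e).differentiable one_ne_zero u) (fun y => hn _)
      fun ξ hξ => ?_
    rw [fderiv_sphereCubeFin] at hξ
    have := eq_zero_of_fderiv_sphereCube_eq_zero hu.1 (hphase _ hu.2) hξ
    funext l
    simpa using congrFun this (e l)
  have hcont := continuous_sphericalJacobian D₀ (contDiff_sphereCubeFin (r := 1) e)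
  have hsign : ∃ D : EuclideanSpace ℂ (Fin (N + 1)) [⋀^Fin (m + 1)]→L[ℝ] ℝ,
      ∀ u ∈ U, 0 < sphericalJacobian D (sphereCubeFin e) u := by
    rcases hUconv.isPreconnected.forall_pos_or_forall_neg hcont.continuousOn hne with h | h
    · exact ⟨D₀, h⟩
    · refine ⟨-D₀, fun u hu => ?_⟩
      have := h u hu
      rw [sphericalJacobian, ContinuousAlternatingMap.curryLeft_apply_apply] at this ⊢
      rw [ContinuousAlternatingMap.neg_apply]
      linarith
  obtain ⟨D, hD⟩ := hsign
  refine ⟨D, 1 / (N + 1), by positivity, fun x hx => ?_, fun x hx hxδ => ?_⟩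
  · rcases eq_or_ne (Int.fract (phaseSum e x)) 0 with h0 | h0
    · refine (sphericalJacobian_sphereCubeFin_eq_zero e D i₀ x ?_).ge
      rw [← Int.floor_add_fract (phaseSum e x), h0, add_zero, unitPhase_intCast]
    · rw [← sphericalJacobian_sphereCubeFin_add_int e D x (-⌊phaseSum e x⌋)]
      refine (hD _ ((hU _).2 ⟨fun i => ?_, ?_⟩)).le
      · simpa using hx (e.symm (some (.inl i))) trivial
      · have : phaseSum e (x + Pi.single (e.symm none) ((-⌊phaseSum e x⌋ : ℤ) : ℝ)) =
            Int.fract (phaseSum e x) := by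
          rw [← Int.self_sub_floor, sub_eq_add_neg, ← Int.cast_neg]
          generalize -⌊phaseSum e x⌋ = k
          simp only [phaseSum, Pi.add_apply, Pi.single_eq_same, add_right_comm]
          simp
        rw [this]
        exact ⟨(Int.fract_nonneg _).lt_of_ne h0.symm, Int.fract_lt_one _⟩
  · refine hD x ((hU x).2 ⟨fun i => hx _ trivial, ?_, ?_⟩)
    · exact add_pos_of_pos_of_nonneg (hx _ trivial).1 (sum_nonneg fun i _ => (hx _ trivial).1.le)
    · have h1 : ∑ i, x (e.symm (some (.inr i))) ≤ ∑ _i : Fin N, (1 / (N + 1) : ℝ) :=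
        sum_le_sum fun i _ => (hxδ _).le
      have h2 := hxδ (e.symm none)
      rw [sum_const, card_univ, Fintype.card_fin, nsmul_eq_mul] at h1
      have h3 : (1 / (N + 1) : ℝ) + N * (1 / (N + 1)) = 1 := by
        field_simp
        ring
      rw [phaseSum]
      linarith

end SphereCubeDegree

section OrbitMap

open Finset Equiv

/-- The restriction of a map from the cube to the simplex `x (π 0) ≥ x (π 1) ≥ ⋯`. -/
def cubeSimplex {X : Type*} [TopologicalSpace X] {m : ℕ} (f : C(Fin (m + 1) → ℝ, X))
    (π : Perm (Fin (m + 1))) : C(stdSimplex ℝ (Fin (m + 2)), X) where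
  toFun x := f (tailSum x.1 ∘ π.symm)
  continuous_toFun := f.continuous.comp (continuous_pi fun l => (continuous_apply (π.symm l)).comp
    ((contDiff_tailSum (r := 0)).continuous.comp continuous_subtype_val))

theorem sum_sign_cubeSimplex_faces_eq_zero {X : Type*} [TopologicalSpace X] {m : ℕ}
    (f : C(Fin (m + 1) → ℝ, X)) (hf : ∀ k, FacesCancel f k)
    (Φ : C(stdSimplex ℝ (Fin (m + 1)), X) → ℝ) :
    ∑ π : Perm (Fin (m + 1)), ((Perm.sign π : ℤ) : ℝ) *
      ∑ i : Fin (m + 2), (-1 : ℝ) ^ (i : ℕ) * Φ ((cubeSimplex f π).comp (stdSimplexFace i)) = 0 := by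
  classical
  have h := sum_sign_faces_eq_zero f hf fun ρ => if h : Continuous ρ then Φ ⟨ρ, h⟩ else 0
  rw [← h]
  refine sum_congr rfl fun π _ => congrArg _ (sum_congr rfl fun i _ => congrArg _ ?_)
  have hc : Continuous fun y : stdSimplex ℝ (Fin (m + 1)) =>
      f (tailSum (i.insertNth 0 y.1) ∘ π.symm) :=
    ((cubeSimplex f π).comp (stdSimplexFace i)).continuous
  rw [dif_pos hc]
  rfl

theorem homologyMap_orbitMap_ne_zero {N m : ℕ}
    (e : Fin (m + 1) ≃ Option (Fin (N + 1) ⊕ Fin (N + 1)))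
    (θ : TopCat.of (Matrix.specialUnitaryGroup (Fin (N + 2)) ℂ) ⟶
      TopCat.of (Metric.sphere (0 : EuclideanSpace ℂ (Fin (N + 2))) 1))
    (hθ : ∀ A : Matrix.specialUnitaryGroup (Fin (N + 2)) ℂ, (θ A).val.ofLp =
      (A : Matrix (Fin (N + 2)) (Fin (N + 2)) ℂ).mulVec (Pi.single 0 1)) :
    (singularHomologyFunctor (m + 1)).map θ ≠ 0 := by
  intro hzero
  have hcube : ∀ x : Option (Fin (N + 1) ⊕ Fin (N + 1)) → ℝ,
      Subtype.val (θ (suCube x)) = sphereCube x := fun x =>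
    WithLp.ofLp_injective 2 ((hθ _).trans (suCube_mulVec_single x))
  have hn : ∀ x : Option (Fin (N + 1) ⊕ Fin (N + 1)) → ℝ, ‖sphereCube x‖ = 1 := by
    intro x
    rw [← hcube]
    exact mem_sphere_zero_iff_norm.1 (θ (suCube x)).2
  have hm : m + 1 = N + 1 + (N + 1) + 1 := by simpa using Fintype.card_congr e
  have hE : Module.finrank ℝ (EuclideanSpace ℂ (Fin (N + 2))) = m + 2 := by
    rw [(WithLp.linearEquiv 2 ℝ (Fin (N + 2) → ℂ)).finrank_eq, Module.finrank_pi_fintype]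
    simp only [Complex.finrank_real_complex, sum_const, card_univ, Fintype.card_fin, smul_eq_mul]
    omega
  obtain ⟨D, δ, hδ, hJ, hJδ⟩ := exists_sphericalJacobian_sphereCubeFin_pos e 0 hn
  have hpos := sum_sign_simplexIntegral_pos D (contDiff_sphereCubeFin e) (fun u => hn _) hJ hδ hJδ
  let f : C(Fin (m + 1) → ℝ, Matrix.specialUnitaryGroup (Fin (N + 2)) ℂ) :=
    ⟨fun u => suCube (u ∘ e.symm),
      continuous_suCube.comp (continuous_pi fun o => continuous_apply (e.symm o))⟩
  have hf : ∀ k, FacesCancel f k := fun k => (facesCancel_suCube (e k)).comp_equiv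
  refine hpos.ne' (sum_simplexIntegral_eq_zero_of_homologyMap_eq_zero hE D θ hzero
    (fun π : Perm (Fin (m + 1)) => ((Perm.sign π : ℤ) : ℝ)) (cubeSimplex f)
    (sum_sign_cubeSimplex_faces_eq_zero f hf) _ (fun π => ?_) fun π x => ?_)
  · exact (contDiff_sphereCubeFin e).comp
      (contDiff_pi.2 fun l => contDiff_pi.1 contDiff_tailSum (π.symm l))
  · exact hcube _

end OrbitMap

/-- the orbit map `θ_N : SU(n) → S^{2n-1}`, `A ↦ A·e₁`, induces a nonzero map on
`(2n-1)`-st singular homology with real coefficients. -/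
theorem SU_orbitMap_nonzero_on_homology
    (n : ℕ) (hn : 2 ≤ n)
    (θ : TopCat.of (Matrix.specialUnitaryGroup (Fin n) ℂ) ⟶
      TopCat.of (Metric.sphere (0 : EuclideanSpace ℂ (Fin n)) 1))
    (hθ : ∀ A : Matrix.specialUnitaryGroup (Fin n) ℂ,
      Subtype.val (θ A) =
        (A : Matrix (Fin n) (Fin n) ℂ).mulVec
          (EuclideanSpace.single (⟨0, by omega⟩ : Fin n) (1 : ℂ))) :
    (singularHomologyFunctor (2 * n - 1)).map θ ≠ 0 := by
  obtain ⟨N, rfl⟩ := Nat.exists_eq_add_of_le' hn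
  have hdim : 2 * (N + 2) - 1 = 2 * (N + 1) + 1 := by omega
  rw [hdim]
  refine homologyMap_orbitMap_ne_zero (Fintype.equivOfCardEq ?_) θ fun A => (hθ A).trans ?_
  · simp
    omega
  · rfl
end
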